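/- Fix a real number u. As x → ∞, (1/x)·#{n : 1 < n ≤ x and ω(n + τ(n)) − log log x ≤ u·√(log log x)} tends to (1/√(2π)) ∫_{−∞}^{u} e^{−t²/2} dt. -/

import Mathlib

open Filter

open Finset in
theorem log_factorial_eq_sum_primesLE (N : ℕ) :
    Real.log (N.factorial : ℝ) =
      ∑ p ∈ Nat.primesLE N, (padicValNat p N.factorial : ℝ) * Real.log p := by
  have h := Nat.prod_factorization_pow_eq_self (Nat.factorial_ne_zero N)
  have hsub : N.factorial.factorization.support = Nat.primesLE N := by
    ext p
    simp only [Nat.support_factorization, Nat.mem_primeFactors, Nat.mem_primesLE]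
    constructor
    · rintro ⟨hp, hd, -⟩
      exact ⟨(hp.dvd_factorial).1 hd, hp⟩
    · rintro ⟨hd, hp⟩
      exact ⟨hp, (hp.dvd_factorial).2 hd, Nat.factorial_ne_zero N⟩
  conv_lhs => rw [← h, Finsupp.prod, hsub]
  rw [Nat.cast_prod, Real.log_prod]
  · refine sum_congr rfl fun p hp => ?_
    rw [Nat.cast_pow, Real.log_pow, Nat.factorization_def _ (Nat.prime_of_mem_primesLE hp)]
  · intro p hp
    have := (Nat.prime_of_mem_primesLE hp).pos
    positivity

theorem div_sub_one_le_padicValNat_factorial {p : ℕ} (hp : p.Prime) (N : ℕ) :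
    (N : ℝ) / p - 1 ≤ padicValNat p N.factorial := by
  have := Fact.mk hp
  have h1 : N / p ≤ padicValNat p N.factorial := by
    have h2 : (p * (N / p)).factorial ∣ N.factorial :=
      Nat.factorial_dvd_factorial (Nat.mul_div_le N p)
    have h3 : padicValNat p (p * (N / p)).factorial ≤ padicValNat p N.factorial :=
      (padicValNat_dvd_iff_le (Nat.factorial_ne_zero N)).1
        (pow_padicValNat_dvd.trans h2)
    rw [padicValNat_factorial_mul] at h3
    omega
  have h4 : (N : ℝ) / p < (N / p : ℕ) + 1 := by
    have hp0 : (0 : ℝ) < p := by exact_mod_cast hp.pos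
    rw [div_lt_iff₀ hp0]
    have := Nat.lt_mul_div_succ N hp.pos
    have h5 : (N : ℝ) < (p * (N / p + 1) : ℕ) := by exact_mod_cast this
    push_cast at h5
    linarith
  have : ((N / p : ℕ) : ℝ) ≤ padicValNat p N.factorial := by exact_mod_cast h1
  linarith

theorem padicValNat_factorial_le_div {p : ℕ} (hp : p.Prime) (N : ℕ) :
    (padicValNat p N.factorial : ℝ) ≤ N / ((p : ℝ) - 1) := by
  have := Fact.mk hp
  have h := sub_one_mul_padicValNat_factorial (p := p) N
  have h1 : (p - 1) * padicValNat p N.factorial ≤ N := by rw [h]; omega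
  have hp1 : (0 : ℝ) < (p : ℝ) - 1 := by
    have : (1 : ℝ) < p := by exact_mod_cast hp.one_lt
    linarith
  rw [le_div_iff₀ hp1]
  have h2 : (((p - 1) * padicValNat p N.factorial : ℕ) : ℝ) ≤ N := by exact_mod_cast h1
  rw [Nat.cast_mul, Nat.cast_sub hp.one_le] at h2
  push_cast at h2
  linarith

open Finset in
/-- **Mertens' first theorem**. -/
theorem exists_abs_sum_log_div_prime_sub_log_le :
    ∃ C : ℝ, ∀ N : ℕ, 1 ≤ N →
      |∑ p ∈ Nat.primesLE N, Real.log p / p - Real.log N| ≤ C := by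
  have hs : Summable fun n : ℕ => 1 / (n : ℝ) ^ (3 / 2 : ℝ) :=
    Real.summable_one_div_nat_rpow.2 (by norm_num)
  set T := ∑' n : ℕ, 1 / (n : ℝ) ^ (3 / 2 : ℝ) with hT
  have hT0 : 0 ≤ T := tsum_nonneg fun n => by positivity
  refine ⟨Real.log 4 + 1 + 4 * T, fun N hN => ?_⟩
  have hN0 : (0 : ℝ) < N := by exact_mod_cast hN
  have hfac := log_factorial_eq_sum_primesLE N
  have hlog4 : 0 ≤ Real.log 4 := Real.log_nonneg (by norm_num)
  rw [abs_le]
  constructor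
  · have hlow : N * Real.log N - N ≤ Real.log (N.factorial : ℝ) := by
      have h1 := Real.pow_div_factorial_le_exp (N : ℝ) (Nat.cast_nonneg N) N
      have h2 := Real.log_le_log (by positivity) h1
      rw [Real.log_exp, Real.log_div (by positivity) (by positivity), Real.log_pow] at h2
      linarith
    have hup : Real.log (N.factorial : ℝ) ≤
        N * (∑ p ∈ Nat.primesLE N, Real.log p / p + 4 * T) := by
      rw [hfac]
      have hTs : ∑ p ∈ Nat.primesLE N, 1 / (p : ℝ) ^ (3 / 2 : ℝ) ≤ T :=
        hs.sum_le_tsum _ fun n _ => by positivity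
      calc ∑ p ∈ Nat.primesLE N, (padicValNat p N.factorial : ℝ) * Real.log p
          ≤ ∑ p ∈ Nat.primesLE N, (N * (Real.log p / p) + N * (4 * (1 / (p : ℝ) ^ (3 / 2 : ℝ)))) := by
            refine sum_le_sum fun p hp => ?_
            have hpp := Nat.prime_of_mem_primesLE hp
            have hp2 : (2 : ℝ) ≤ p := by exact_mod_cast hpp.two_le
            have hl0 : 0 ≤ Real.log p := Real.log_nonneg (by linarith)
            have h1 := mul_le_mul_of_nonneg_right (padicValNat_factorial_le_div hpp N) hl0
            refine h1.trans ?_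
            have hlog : Real.log p ≤ 2 * Real.sqrt p := by
              have h3 := Real.log_le_sub_one_of_pos (x := Real.sqrt p)
                (Real.sqrt_pos.2 (by linarith))
              rw [Real.log_sqrt (by linarith)] at h3
              linarith
            have hp32 : (p : ℝ) ^ (3 / 2 : ℝ) = p * Real.sqrt p := by
              rw [show (3 / 2 : ℝ) = 1 + 1 / 2 by norm_num, Real.rpow_add (by linarith),
                Real.rpow_one, Real.sqrt_eq_rpow]
            have hsq : Real.sqrt p * Real.sqrt p = p := Real.mul_self_sqrt (by linarith)
            have hsp : 0 < Real.sqrt p := Real.sqrt_pos.2 (by linarith)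
            have h4 : Real.log p / ((p : ℝ) - 1) = Real.log p / p + Real.log p / (p * (p - 1)) := by
              have : (p : ℝ) - 1 ≠ 0 := by linarith
              field_simp
              ring
            have h5 : Real.log p / (p * ((p : ℝ) - 1)) ≤ 4 * (1 / (p : ℝ) ^ (3 / 2 : ℝ)) := by
              rw [hp32, mul_one_div, div_le_div_iff₀ (by nlinarith) (by positivity)]
              calc Real.log p * (p * Real.sqrt p) ≤ (2 * Real.sqrt p) * (p * Real.sqrt p) := by
                    gcongr
                _ = 2 * (p * p) := by linear_combination (2 * (p : ℝ)) * hsq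
                _ ≤ 4 * (p * (p - 1)) := by nlinarith
            calc (N : ℝ) / (p - 1) * Real.log p = N * (Real.log p / (p - 1)) := by ring
              _ ≤ N * (Real.log p / p + 4 * (1 / (p : ℝ) ^ (3 / 2 : ℝ))) := by
                  rw [h4]; gcongr
              _ = _ := by ring
        _ = N * (∑ p ∈ Nat.primesLE N, Real.log p / p
              + 4 * ∑ p ∈ Nat.primesLE N, 1 / (p : ℝ) ^ (3 / 2 : ℝ)) := by
            rw [sum_add_distrib, ← mul_sum, ← mul_sum, ← mul_sum]; ring
        _ ≤ _ := by gcongr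
    have h := hlow.trans hup
    have h' : N * (Real.log N - 1) ≤ N * (∑ p ∈ Nat.primesLE N, Real.log p / p + 4 * T) := by
      linarith
    have := le_of_mul_le_mul_left h' hN0
    linarith
  · have hup : Real.log (N.factorial : ℝ) ≤ N * Real.log N := by
      rw [← Real.log_pow]
      apply Real.log_le_log (by positivity)
      exact_mod_cast Nat.factorial_le_pow N
    have hlow : N * ∑ p ∈ Nat.primesLE N, Real.log p / p - Real.log 4 * N
        ≤ Real.log (N.factorial : ℝ) := by
      have hth := Chebyshev.theta_le_log4_mul_x (x := N) hN0.le
      rw [Chebyshev.theta_eq_sum_primesLE_log] at hth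
      rw [hfac]
      calc _ ≤ N * ∑ p ∈ Nat.primesLE N, Real.log p / p - ∑ p ∈ Nat.primesLE N, Real.log p := by
            linarith
        _ = ∑ p ∈ Nat.primesLE N, ((N : ℝ) / p - 1) * Real.log p := by
            rw [mul_sum, ← sum_sub_distrib]
            exact sum_congr rfl fun p _ => by ring
        _ ≤ _ := by
            refine sum_le_sum fun p hp => ?_
            have hpp := Nat.prime_of_mem_primesLE hp
            have hl0 : 0 ≤ Real.log p := Real.log_nonneg (by exact_mod_cast hpp.one_le)
            exact mul_le_mul_of_nonneg_right (div_sub_one_le_padicValNat_factorial hpp N) hl0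
    have h := hlow.trans hup
    have h' : N * ∑ p ∈ Nat.primesLE N, Real.log p / p ≤ N * (Real.log N + Real.log 4) := by
      linarith
    have := le_of_mul_le_mul_left h' hN0
    linarith

theorem abs_one_sub_div_sub_log_sub_log_le {a b : ℝ} (ha : 0 < a) (hab : a ≤ b) (hb : b ≤ a + 1) :
    |1 - a / b - (Real.log b - Real.log a)| ≤ 1 / a - 1 / b := by
  have hb0 : 0 < b := ha.trans_le hab
  have h1 : Real.log b - Real.log a ≤ b / a - 1 := by
    rw [← Real.log_div hb0.ne' ha.ne']
    exact Real.log_le_sub_one_of_pos (by positivity)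
  have h2 : Real.log a - Real.log b ≤ a / b - 1 := by
    rw [← Real.log_div ha.ne' hb0.ne']
    exact Real.log_le_sub_one_of_pos (by positivity)
  have h3 : b / a + a / b - 2 ≤ 1 / a - 1 / b := by
    rw [div_add_div _ _ ha.ne' hb0.ne', div_sub_div _ _ ha.ne' hb0.ne', sub_le_iff_le_add,
      div_add' _ _ _ (by positivity)]
    rw [div_le_div_iff_of_pos_right (by positivity)]
    nlinarith
  rw [abs_le]
  constructor <;> linarith

open Finset in
theorem exists_abs_sum_inv_prime_sub_log_log_le_nat :
    ∃ C : ℝ, ∀ N : ℕ, 2 ≤ N →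
      |∑ p ∈ Nat.primesLE N, (1 : ℝ) / p - Real.log (Real.log N)| ≤ C := by
  obtain ⟨C, hC⟩ := exists_abs_sum_log_div_prime_sub_log_le
  have hC0 : 0 ≤ C := (abs_nonneg _).trans (hC 1 le_rfl)
  set A : ℕ → ℝ := fun n => ∑ p ∈ Nat.primesLE n, Real.log p / p with hA
  set D : ℕ → ℝ := fun n => ∑ p ∈ Nat.primesLE n, (1 : ℝ) / p - A n / Real.log n
    - Real.log (Real.log n) with hD
  have hlogpos : ∀ n : ℕ, 2 ≤ n → 0 < Real.log n := fun n hn =>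
    Real.log_pos (by exact_mod_cast hn)
  have hstep : ∀ n : ℕ, 2 ≤ n →
      |D (n + 1) - D n| ≤ (C + 1) * (1 / Real.log n - 1 / Real.log (n + 1 : ℕ)) := by
    intro n hn
    have ha := hlogpos n hn
    have hb := hlogpos (n + 1) (by omega)
    set a := Real.log n with had
    set b := Real.log (n + 1 : ℕ) with hbd
    have hab : a ≤ b := Real.log_le_log (by positivity) (by push_cast; linarith)
    have hba : b ≤ a + 1 := by
      have : b - a ≤ 1 := by
        have hn0 : (0 : ℝ) < n := by positivity
        rw [hbd, had, ← Real.log_div (by positivity) hn0.ne']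
        refine (Real.log_le_sub_one_of_pos (by positivity)).trans ?_
        have hn2 : (2 : ℝ) ≤ n := by exact_mod_cast hn
        rw [sub_le_iff_le_add, div_le_iff₀ hn0]
        push_cast
        linarith
      linarith
    have hinv : 0 ≤ 1 / a - 1 / b := by
      rw [sub_nonneg]; exact one_div_le_one_div_of_le ha hab
    have hkey : D (n + 1) - D n =
        (1 - a / b - (Real.log b - Real.log a)) + (A n - a) * (1 / a - 1 / b) := by
      have hAs : ∑ p ∈ Nat.primesLE (n + 1), (1 : ℝ) / p - A (n + 1) / b =
          ∑ p ∈ Nat.primesLE n, (1 : ℝ) / p - A n / b := by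
        simp only [hA]
        rw [Nat.primesLE_succ]
        split_ifs with hp
        · rw [sum_insert (Nat.notMem_primesLE n), sum_insert (Nat.notMem_primesLE n), ← hbd]
          field_simp
          ring
        · rfl
      simp only [hD]
      rw [← hbd, ← had]
      have : ∑ p ∈ Nat.primesLE (n + 1), (1 : ℝ) / p =
          A (n + 1) / b + (∑ p ∈ Nat.primesLE n, (1 : ℝ) / p - A n / b) := by
        rw [← hAs]; ring
      rw [this]
      field_simp
      ring
    rw [hkey]
    refine (abs_add_le _ _).trans ?_
    rw [abs_mul, abs_of_nonneg hinv]
    have h1 := abs_one_sub_div_sub_log_sub_log_le ha hab hba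
    have h2 := mul_le_mul_of_nonneg_right (hC n (by omega)) hinv
    simp only [hA]
    rw [← had] at h2
    linarith
  have hD' : ∀ n : ℕ, 2 ≤ n →
      |D n - D 2| ≤ (C + 1) * (1 / Real.log (2 : ℕ) - 1 / Real.log n) := by
    intro n hn
    induction n, hn using Nat.le_induction with
    | base => simp
    | succ n hn ih =>
      have := hstep n hn
      calc |D (n + 1) - D 2| = |(D (n + 1) - D n) + (D n - D 2)| := by ring_nf
        _ ≤ _ := abs_add_le _ _
        _ ≤ _ := by linarith
  refine ⟨(C + 1) * (1 / Real.log (2 : ℕ)) + |D 2| + C / Real.log 2 + 1, fun N hN => ?_⟩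
  have ha := hlogpos N hN
  have h1 := hD' N hN
  have h2 : |A N / Real.log N - 1| ≤ C / Real.log 2 := by
    rw [div_sub_one ha.ne', abs_div, abs_of_pos ha]
    have hl2 : Real.log 2 ≤ Real.log N :=
      Real.log_le_log (by norm_num) (by exact_mod_cast hN)
    have := hC N (by omega)
    have hl20 : 0 < Real.log 2 := Real.log_pos (by norm_num)
    gcongr
  have h3 : ∑ p ∈ Nat.primesLE N, (1 : ℝ) / p - Real.log (Real.log N) =
      (D N - D 2) + D 2 + (A N / Real.log N - 1) + 1 := by
    simp only [hD]; ring
  rw [h3]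
  have h4 : 0 ≤ (C + 1) * (1 / Real.log N) := by positivity
  calc _ ≤ |D N - D 2| + |D 2| + |A N / Real.log N - 1| + |(1 : ℝ)| := by
        refine (abs_add_le _ _).trans ?_
        gcongr
        refine (abs_add_le _ _).trans ?_
        gcongr
        exact abs_add_le _ _
    _ ≤ _ := by rw [abs_one]; linarith

/-- **Mertens' second theorem**, without the constant. -/
theorem exists_abs_sum_inv_prime_sub_log_log_le :
    ∃ C : ℝ, ∀ x : ℝ, 2 ≤ x →
      |∑ p ∈ Nat.primesLE ⌊x⌋₊, (1 : ℝ) / p - Real.log (Real.log x)| ≤ C := by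
  obtain ⟨C, hC⟩ := exists_abs_sum_inv_prime_sub_log_log_le_nat
  refine ⟨C + Real.log 2, fun x hx => ?_⟩
  have hN : 2 ≤ ⌊x⌋₊ := Nat.le_floor (by exact_mod_cast hx)
  have hN2 : (2 : ℝ) ≤ ⌊x⌋₊ := by exact_mod_cast hN
  have hle : (⌊x⌋₊ : ℝ) ≤ x := Nat.floor_le (by linarith)
  have hlt : x < ⌊x⌋₊ + 1 := Nat.lt_floor_add_one x
  have hl0 : 0 < Real.log ⌊x⌋₊ := Real.log_pos (by linarith)
  have h1 : Real.log (Real.log ⌊x⌋₊) ≤ Real.log (Real.log x) :=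
    Real.log_le_log hl0 (Real.log_le_log (by linarith) hle)
  have h2 : Real.log (Real.log x) ≤ Real.log 2 + Real.log (Real.log ⌊x⌋₊) := by
    rw [← Real.log_mul (by norm_num) hl0.ne']
    apply Real.log_le_log (Real.log_pos (by linarith))
    rw [← Nat.cast_ofNat, ← Real.log_pow]
    apply Real.log_le_log (by linarith)
    nlinarith
  have h3 := hC _ hN
  rw [abs_le] at h3 ⊢
  have : 0 ≤ Real.log 2 := Real.log_nonneg (by norm_num)
  constructor <;> linarith

open Finset in
theorem sum_powersetCard_succ_insert_prod {ι R : Type*} [DecidableEq ι] [CommSemiring R]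
    {s : Finset ι} {i : ι} (hi : i ∉ s) (x : ι → R) (k : ℕ) :
    ∑ D ∈ (insert i s).powersetCard (k + 1), ∏ j ∈ D, x j =
      ∑ D ∈ s.powersetCard (k + 1), ∏ j ∈ D, x j +
        x i * ∑ D ∈ s.powersetCard k, ∏ j ∈ D, x j := by
  rw [powersetCard_succ_insert hi, sum_union, sum_image, mul_sum]
  · congr 1
    refine sum_congr rfl fun D hD => ?_
    rw [prod_insert fun h => hi ((mem_powersetCard.1 hD).1 h)]
  · intro D hD D' hD' h
    have h1 : i ∉ D := fun h => hi ((mem_powersetCard.1 hD).1 h)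
    have h2 : i ∉ D' := fun h => hi ((mem_powersetCard.1 hD').1 h)
    rw [← erase_insert h1, ← erase_insert h2, h]
  · rw [disjoint_left]
    intro D hD hD'
    obtain ⟨D', -, rfl⟩ := mem_image.1 hD'
    exact hi ((mem_powersetCard.1 hD).1 (mem_insert_self _ _))

open Finset in
/-- Truncating the expansion of a product of factors in the unit disc costs at most the first
omitted elementary symmetric function of the absolute values. -/
theorem norm_prod_one_add_sub_sum_powersetCard_le {ι : Type*} (s : Finset ι)
    (x : ι → ℂ) (hx : ∀ i ∈ s, ‖1 + x i‖ ≤ 1) (K : ℕ) :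
    ‖∏ i ∈ s, (1 + x i) - ∑ j ∈ range K, ∑ D ∈ s.powersetCard j, ∏ i ∈ D, x i‖ ≤
      ∑ D ∈ s.powersetCard K, ∏ i ∈ D, ‖x i‖ := by
  classical
  induction s using Finset.induction_on generalizing K with
  | empty =>
    rcases K with _ | K
    · simp
    · rw [sum_range_succ']
      have h : ∀ j, powersetCard (j + 1) (∅ : Finset ι) = ∅ := fun j =>
        powersetCard_eq_empty.2 (by simp)
      simp [h]
  | insert i s hi ih =>
    have hxs : ∀ j ∈ s, ‖1 + x j‖ ≤ 1 := fun j hj => hx j (mem_insert_of_mem hj)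
    have hxi := hx i (mem_insert_self _ _)
    rcases K with _ | K
    · simp only [range_zero, sum_empty, sub_zero, powersetCard_zero, sum_singleton, prod_empty]
      rw [norm_prod]
      exact prod_le_one (fun _ _ => norm_nonneg _) hx
    · have hE : ∑ j ∈ range (K + 1), ∑ D ∈ (insert i s).powersetCard j, ∏ i ∈ D, x i =
          ∑ j ∈ range (K + 1), ∑ D ∈ s.powersetCard j, ∏ i ∈ D, x i +
          x i * ∑ j ∈ range K, ∑ D ∈ s.powersetCard j, ∏ i ∈ D, x i := by
        rw [sum_range_succ', sum_congr rfl fun j _ => sum_powersetCard_succ_insert_prod hi x j,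
          sum_add_distrib, ← mul_sum, sum_range_succ']
        simp only [powersetCard_zero]
        ring
      rw [hE, prod_insert hi, sum_powersetCard_succ_insert_prod hi]
      have h1 := ih hxs (K + 1)
      set P := ∏ j ∈ s, (1 + x j)
      have hK : ∑ j ∈ range (K + 1), ∑ D ∈ s.powersetCard j, ∏ i ∈ D, x i =
        ∑ j ∈ range K, ∑ D ∈ s.powersetCard j, ∏ i ∈ D, x i +
          ∑ D ∈ s.powersetCard K, ∏ i ∈ D, x i := sum_range_succ _ _
      set E1 := ∑ j ∈ range (K + 1), ∑ D ∈ s.powersetCard j, ∏ i ∈ D, x i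
      set E0 := ∑ j ∈ range K, ∑ D ∈ s.powersetCard j, ∏ i ∈ D, x i
      have h2 : (1 + x i) * P - (E1 + x i * E0) = (1 + x i) * (P - E1) + x i * (E1 - E0) := by
        ring
      rw [h2, hK, add_sub_cancel_left, ← hK]
      refine (norm_add_le _ _).trans (add_le_add ?_ ?_)
      · rw [norm_mul]
        calc _ ≤ 1 * ‖P - E1‖ := by gcongr
          _ ≤ _ := by rw [one_mul]; exact h1
      · rw [norm_mul]
        gcongr
        refine (norm_sum_le _ _).trans (le_of_eq ?_)
        exact sum_congr rfl fun D _ => norm_prod _ _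

theorem pow_succ_add_mul_pow_le_add_pow {S a : ℝ} (hS : 0 ≤ S) (ha : 0 ≤ a) (K : ℕ) :
    S ^ (K + 1) + (K + 1) * a * S ^ K ≤ (S + a) ^ (K + 1) := by
  induction K with
  | zero => simp
  | succ K ih =>
    have h := mul_le_mul_of_nonneg_right ih (add_nonneg hS ha)
    have h0 : 0 ≤ (K + 1 : ℝ) * a * S ^ K * a := by positivity
    rw [pow_succ (S + a) (K + 1)]
    refine le_trans ?_ h
    push_cast
    ring_nf at h0 ⊢
    linarith

open Finset in
theorem sum_powersetCard_prod_le {ι : Type*} (s : Finset ι) (a : ι → ℝ)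
    (ha : ∀ i ∈ s, 0 ≤ a i) (K : ℕ) :
    ∑ D ∈ s.powersetCard K, ∏ i ∈ D, a i ≤ (∑ i ∈ s, a i) ^ K / K.factorial := by
  classical
  induction s using Finset.induction_on generalizing K with
  | empty =>
    rcases K with _ | K
    · simp
    · rw [powersetCard_eq_empty.2 (by simp)]; simp
  | insert i s hi ih =>
    have has : ∀ j ∈ s, 0 ≤ a j := fun j hj => ha j (mem_insert_of_mem hj)
    have hai := ha i (mem_insert_self _ _)
    rcases K with _ | K
    · simp
    · rw [sum_powersetCard_succ_insert_prod hi, sum_insert hi]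
      have h1 := ih has (K + 1)
      have h2 := mul_le_mul_of_nonneg_left (ih has K) hai
      refine (add_le_add h1 h2).trans ?_
      have h3 := pow_succ_add_mul_pow_le_add_pow (sum_nonneg has) hai K
      rw [add_comm (a i)]
      refine le_trans (le_of_eq ?_) (div_le_div_of_nonneg_right h3 (Nat.cast_nonneg _))
      rw [Nat.factorial_succ]
      push_cast
      field_simp

open Finset in
theorem sum_range_mul_of_periodic {R : Type*} [CommRing R] {f : ℕ → R} {q : ℕ}
    (hf : Function.Periodic f q) (k : ℕ) :
    ∑ m ∈ range (q * k), f m = k * ∑ m ∈ range q, f m := by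
  induction k with
  | zero => simp
  | succ k ih =>
    rw [mul_add_one, sum_range_add, ih]
    have : ∀ m, f (q * k + m) = f m := fun m => by
      rw [add_comm, mul_comm]; exact hf.nat_mul k m
    simp only [this]
    push_cast
    ring

open Finset in
theorem norm_sum_range_sub_le_of_periodic {𝕜 : Type*} [RCLike 𝕜] {f : ℕ → 𝕜} {q : ℕ} (hq : 0 < q)
    (hf : Function.Periodic f q) {B : ℝ} (hB : ∀ m, ‖f m‖ ≤ B) (M : ℕ) :
    ‖∑ m ∈ range M, f m - (M : 𝕜) * ((∑ m ∈ range q, f m) / q)‖ ≤ 2 * q * B := by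
  have hB0 : 0 ≤ B := (norm_nonneg _).trans (hB 0)
  have hdiv : M = q * (M / q) + M % q := (Nat.div_add_mod M q).symm
  have hsum : ∑ m ∈ range M, f m =
      (M / q : ℕ) * ∑ m ∈ range q, f m + ∑ m ∈ range (M % q), f (q * (M / q) + m) := by
    conv_lhs => rw [hdiv]
    rw [sum_range_add, sum_range_mul_of_periodic hf]
  have hM : (M : 𝕜) = q * (M / q : ℕ) + (M % q : ℕ) := by
    exact_mod_cast congrArg (Nat.cast (R := 𝕜)) hdiv
  have hq0 : (q : 𝕜) ≠ 0 := by exact_mod_cast hq.ne'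
  have hkey : ∑ m ∈ range M, f m - (M : 𝕜) * ((∑ m ∈ range q, f m) / q) =
      ∑ m ∈ range (M % q), f (q * (M / q) + m) -
        ((M % q : ℕ) : 𝕜) * ((∑ m ∈ range q, f m) / q) := by
    rw [hsum, hM]
    field_simp
    ring
  have hr : ((M % q : ℕ) : ℝ) ≤ q := by exact_mod_cast (Nat.mod_lt M hq).le
  have h1 : ‖∑ m ∈ range (M % q), f (q * (M / q) + m)‖ ≤ (M % q : ℕ) * B := by
    refine (norm_sum_le_of_le _ fun m _ => hB _).trans ?_
    simp
  have h2 : ‖∑ m ∈ range q, f m‖ ≤ q * B := by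
    refine (norm_sum_le_of_le _ fun m _ => hB _).trans ?_
    simp
  have hqr : (0 : ℝ) < q := by exact_mod_cast hq
  have h3 : ‖((M % q : ℕ) : 𝕜) * ((∑ m ∈ range q, f m) / q)‖ ≤ (M % q : ℕ) * B := by
    rw [norm_mul, norm_div, RCLike.norm_natCast, RCLike.norm_natCast]
    gcongr
    rw [div_le_iff₀ hqr]
    linarith
  rw [hkey]
  refine (norm_sub_le _ _).trans ?_
  nlinarith

open Finset in
theorem sum_range_mul_eq_of_coprime {R : Type*} [CommRing R] {f g : ℕ → R} {a b : ℕ}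
    (hab : a.Coprime b) (ha : 0 < a) (hb : 0 < b)
    (hf : Function.Periodic f a) (hg : Function.Periodic g b) :
    ∑ m ∈ range (a * b), f m * g m = (∑ m ∈ range a, f m) * ∑ m ∈ range b, g m := by
  rw [sum_mul_sum, ← sum_product']
  refine sum_bij (fun m _ => (m % a, m % b)) ?_ ?_ ?_ ?_
  · intro m _
    simp [Nat.mod_lt _ ha, Nat.mod_lt _ hb]
  · intro m hm m' hm' h
    simp only [Prod.mk.injEq] at h
    have h1 : m ≡ m' [MOD a * b] := (Nat.modEq_and_modEq_iff_modEq_mul hab).1 ⟨h.1, h.2⟩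
    exact Nat.ModEq.eq_of_lt_of_lt h1 (mem_range.1 hm) (mem_range.1 hm')
  · rintro ⟨u, v⟩ huv
    simp only [mem_product, mem_range] at huv
    refine ⟨Nat.chineseRemainder hab u v, ?_, ?_⟩
    · exact mem_range.2 (Nat.chineseRemainder_lt_mul hab u v ha.ne' hb.ne')
    · have h := (Nat.chineseRemainder hab u v).2
      simp only [Prod.mk.injEq]
      exact ⟨Eq.trans h.1 (Nat.mod_eq_of_lt huv.1), Eq.trans h.2 (Nat.mod_eq_of_lt huv.2)⟩
  · intro m _
    rw [hf.map_mod_nat, hg.map_mod_nat]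

open Finset in
theorem periodic_prod {R : Type*} [CommRing R] {X : ℕ → ℕ → R} {D : Finset ℕ}
    (hX : ∀ r ∈ D, Function.Periodic (X r) r) :
    Function.Periodic (fun m => ∏ r ∈ D, X r m) (∏ r ∈ D, r) := by
  intro m
  refine prod_congr rfl fun r hr => ?_
  obtain ⟨c, hc⟩ := dvd_prod_of_mem (fun r : ℕ => r) hr
  rw [hc, mul_comm]
  exact (hX r hr).nat_mul c m

open Finset in
theorem sum_range_prod_eq_prod_sum {R : Type*} [CommRing R] {X : ℕ → ℕ → R} {D : Finset ℕ}
    (hD : ∀ r ∈ D, r.Prime) (hX : ∀ r ∈ D, Function.Periodic (X r) r) :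
    ∑ m ∈ range (∏ r ∈ D, r), ∏ r ∈ D, X r m = ∏ r ∈ D, ∑ m ∈ range r, X r m := by
  induction D using Finset.induction_on with
  | empty => simp
  | insert p D hp ih =>
    have hD' : ∀ r ∈ D, r.Prime := fun r hr => hD r (mem_insert_of_mem hr)
    have hX' : ∀ r ∈ D, Function.Periodic (X r) r := fun r hr => hX r (mem_insert_of_mem hr)
    have hpp := hD p (mem_insert_self _ _)
    rw [prod_insert hp, prod_insert hp, ← ih hD' hX',
      ← sum_range_mul_eq_of_coprime _ hpp.pos (prod_pos fun r hr => (hD' r hr).pos)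
        (hX p (mem_insert_self _ _)) (periodic_prod hX')]
    · exact sum_congr rfl fun m _ => prod_insert hp
    · refine Nat.Coprime.prod_right fun r hr => ?_
      rw [Nat.coprime_primes hpp (hD' r hr)]
      rintro rfl
      exact hp hr

open Finset in
theorem norm_sum_range_prod_sub_le {𝕜 : Type*} [RCLike 𝕜] {X : ℕ → ℕ → 𝕜} {D : Finset ℕ} {z : ℕ}
    (hD : ∀ r ∈ D, r.Prime) (hz : ∀ r ∈ D, r ≤ z) (hX : ∀ r ∈ D, Function.Periodic (X r) r)
    (hb : ∀ r ∈ D, ∀ m, ‖X r m‖ ≤ 2) (M : ℕ) :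
    ‖∑ m ∈ range M, ∏ r ∈ D, X r m - (M : 𝕜) * ∏ r ∈ D, ((∑ m ∈ range r, X r m) / r)‖ ≤
      2 * (2 * z) ^ #D := by
  have h := norm_sum_range_sub_le_of_periodic (prod_pos fun r hr => (hD r hr).pos)
    (periodic_prod hX) (B := 2 ^ #D) (fun m => by
      rw [norm_prod]
      exact (prod_le_prod (fun _ _ => norm_nonneg _) fun r hr => hb r hr m).trans (by simp)) M
  rw [sum_range_prod_eq_prod_sum hD hX, Nat.cast_prod, ← prod_div_distrib] at h
  refine h.trans ?_
  have h1 : ((∏ r ∈ D, r : ℕ) : ℝ) ≤ (z : ℝ) ^ #D := by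
    exact_mod_cast prod_le_pow_card D (fun r => r) z hz
  rw [mul_pow]
  have : (0 : ℝ) ≤ 2 ^ #D := by positivity
  nlinarith

open Finset in
theorem sum_powersetCard_le_of_le_pow {R : Finset ℕ} {z : ℕ} (hz : ∀ r ∈ R, r ∈ Icc 1 z)
    (j : ℕ) (F : Finset ℕ → ℝ) (hF : ∀ D ∈ R.powersetCard j, F D ≤ 2 * (2 * z) ^ j) :
    ∑ D ∈ R.powersetCard j, F D ≤ 2 * (2 * (z : ℝ) ^ 2) ^ j := by
  refine (sum_le_sum hF).trans ?_
  rw [sum_const, card_powersetCard, nsmul_eq_mul]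
  have h1 : #R ≤ z := by
    have := card_le_card (show R ⊆ Icc 1 z from hz)
    simpa using this
  have h2 : (((#R).choose j : ℕ) : ℝ) ≤ (z : ℝ) ^ j := by
    have : (#R).choose j ≤ z ^ j :=
      (Nat.choose_le_pow (#R) j).trans (Nat.pow_le_pow_left h1 j)
    exact_mod_cast this
  calc _ ≤ (z : ℝ) ^ j * (2 * (2 * z) ^ j) := by gcongr
    _ = _ := by rw [mul_pow, mul_pow, ← pow_mul]; ring

open Finset in
/-- Periodic functions to distinct prime moduli are nearly independent on an interval. -/
theorem norm_sum_prod_one_add_sub_le {R : Finset ℕ} {z : ℕ} (hR : ∀ r ∈ R, r.Prime)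
    (hz : ∀ r ∈ R, r ≤ z) (hz1 : 1 ≤ z) {X : ℕ → ℕ → ℂ}
    (hX : ∀ r ∈ R, Function.Periodic (X r) r) (h1 : ∀ r ∈ R, ∀ m, ‖1 + X r m‖ ≤ 1) (K M : ℕ) :
    ‖∑ m ∈ range M, ∏ r ∈ R, (1 + X r m) -
        (M : ℂ) * ∏ r ∈ R, (1 + (∑ m ∈ range r, X r m) / r)‖ ≤
      2 * M * ((∑ r ∈ R, (∑ m ∈ range r, ‖X r m‖) / r) ^ K / K.factorial) +
        2 * (K + 1) * (2 * (z : ℝ) ^ 2) ^ K := by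
  have hb : ∀ r ∈ R, ∀ m, ‖X r m‖ ≤ 2 := fun r hr m => by
    have h : X r m = (1 + X r m) - 1 := by ring
    rw [h]
    refine (norm_sub_le _ _).trans ?_
    rw [norm_one]
    linarith [h1 r hr m]
  have hRz : ∀ r ∈ R, r ∈ Icc 1 z := fun r hr => mem_Icc.2 ⟨(hR r hr).one_le, hz r hr⟩
  set avg : ℕ → ℂ := fun r => (∑ m ∈ range r, X r m) / r with havg
  set A : ℕ → ℝ := fun r => (∑ m ∈ range r, ‖X r m‖) / r with hA
  have hA0 : ∀ r ∈ R, 0 ≤ A r := fun r _ => by simp only [hA]; positivity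
  have havgA : ∀ r ∈ R, ‖avg r‖ ≤ A r := fun r _ => by
    simp only [havg, hA]
    rw [norm_div, RCLike.norm_natCast]
    gcongr
    exact norm_sum_le _ _
  have h1avg : ∀ r ∈ R, ‖1 + avg r‖ ≤ 1 := fun r hr => by
    have hr0 : (r : ℂ) ≠ 0 := by exact_mod_cast (hR r hr).ne_zero
    have hr1 : (0 : ℝ) < r := by exact_mod_cast (hR r hr).pos
    have : 1 + avg r = (∑ m ∈ range r, (1 + X r m)) / r := by
      simp only [havg]
      rw [sum_add_distrib]
      simp
      field_simp
    rw [this, norm_div, RCLike.norm_natCast, div_le_one hr1]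
    refine (norm_sum_le_of_le _ fun m _ => h1 r hr m).trans ?_
    simp
  set e := (∑ r ∈ R, A r) ^ K / K.factorial with he
  have hT1 : ‖∑ m ∈ range M, ∏ r ∈ R, (1 + X r m) -
      ∑ m ∈ range M, ∑ j ∈ range K, ∑ D ∈ R.powersetCard j, ∏ r ∈ D, X r m‖ ≤
      M * e + 2 * (2 * (z : ℝ) ^ 2) ^ K := by
    rw [← sum_sub_distrib]
    refine (norm_sum_le_of_le _ fun m _ =>
      norm_prod_one_add_sub_sum_powersetCard_le R (fun r => X r m) (fun r hr => h1 r hr m) K).trans ?_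
    rw [sum_comm]
    have h2 : ∑ D ∈ R.powersetCard K, (∑ m ∈ range M, ∏ r ∈ D, ‖X r m‖ - M * ∏ r ∈ D, A r) ≤
        2 * (2 * (z : ℝ) ^ 2) ^ K := by
      refine sum_powersetCard_le_of_le_pow hRz K _ fun D hD => ?_
      obtain ⟨hDR, hDc⟩ := mem_powersetCard.1 hD
      have := norm_sum_range_prod_sub_le (𝕜 := ℝ) (X := fun r m => ‖X r m‖) (D := D) (z := z)
        (fun r hr => hR r (hDR hr)) (fun r hr => hz r (hDR hr))
        (fun r hr m => by simp only [hX r (hDR hr) m])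
        (fun r hr m => by simpa using hb r (hDR hr) m) M
      rw [hDc] at this
      exact (le_abs_self _).trans this
    rw [sum_sub_distrib, ← mul_sum] at h2
    have h3 := mul_le_mul_of_nonneg_left (sum_powersetCard_prod_le R A hA0 K) (Nat.cast_nonneg M)
    linarith
  have hT2 : ‖(M : ℂ) * ∏ r ∈ R, (1 + avg r) -
      (M : ℂ) * ∑ j ∈ range K, ∑ D ∈ R.powersetCard j, ∏ r ∈ D, avg r‖ ≤ M * e := by
    rw [← mul_sub, norm_mul, RCLike.norm_natCast]
    gcongr
    refine (norm_prod_one_add_sub_sum_powersetCard_le R avg h1avg K).trans ?_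
    refine le_trans ?_ (sum_powersetCard_prod_le R A hA0 K)
    refine sum_le_sum fun D hD => ?_
    exact prod_le_prod (fun _ _ => norm_nonneg _) fun r hr =>
      havgA r ((mem_powersetCard.1 hD).1 hr)
  have hT3 : ‖∑ m ∈ range M, ∑ j ∈ range K, ∑ D ∈ R.powersetCard j, ∏ r ∈ D, X r m -
      (M : ℂ) * ∑ j ∈ range K, ∑ D ∈ R.powersetCard j, ∏ r ∈ D, avg r‖ ≤
      2 * K * (2 * (z : ℝ) ^ 2) ^ K := by
    rw [sum_comm, mul_sum, ← sum_sub_distrib]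
    have hone : (1 : ℝ) ≤ 2 * (z : ℝ) ^ 2 := by
      have : (1 : ℝ) ≤ z := by exact_mod_cast hz1
      nlinarith
    have : ∀ j ∈ range K, ‖∑ m ∈ range M, ∑ D ∈ R.powersetCard j, ∏ r ∈ D, X r m -
        (M : ℂ) * ∑ D ∈ R.powersetCard j, ∏ r ∈ D, avg r‖ ≤ 2 * (2 * (z : ℝ) ^ 2) ^ K := by
      intro j hj
      rw [sum_comm, mul_sum, ← sum_sub_distrib]
      refine (norm_sum_le _ _).trans ?_
      refine (sum_powersetCard_le_of_le_pow hRz j _ fun D hD => ?_).trans ?_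
      · obtain ⟨hDR, hDc⟩ := mem_powersetCard.1 hD
        have := norm_sum_range_prod_sub_le (X := X) (D := D) (z := z)
          (fun r hr => hR r (hDR hr)) (fun r hr => hz r (hDR hr))
          (fun r hr => hX r (hDR hr)) (fun r hr => hb r (hDR hr)) M
        rwa [hDc] at this
      · have := pow_le_pow_right₀ hone (mem_range.1 hj).le
        linarith
    refine (norm_sum_le_of_le _ this).trans ?_
    rw [sum_const, card_range, nsmul_eq_mul]
    linarith
  set a1 := ∑ m ∈ range M, ∏ r ∈ R, (1 + X r m)
  set a2 := ∑ m ∈ range M, ∑ j ∈ range K, ∑ D ∈ R.powersetCard j, ∏ r ∈ D, X r m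
  set a3 := (M : ℂ) * ∑ j ∈ range K, ∑ D ∈ R.powersetCard j, ∏ r ∈ D, avg r
  set a4 := (M : ℂ) * ∏ r ∈ R, (1 + avg r)
  have : a1 - a4 = (a1 - a2) + (a2 - a3) - (a4 - a3) := by ring
  rw [this]
  refine (norm_sub_le _ _).trans ?_
  have := norm_add_le (a1 - a2) (a2 - a3)
  linarith

open Finset in
theorem norm_prod_sub_prod_le_sum {ι : Type*} (s : Finset ι) (a b : ι → ℂ)
    (ha : ∀ i ∈ s, ‖a i‖ ≤ 1) (hb : ∀ i ∈ s, ‖b i‖ ≤ 1) :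
    ‖∏ i ∈ s, a i - ∏ i ∈ s, b i‖ ≤ ∑ i ∈ s, ‖a i - b i‖ := by
  classical
  induction s using Finset.induction_on with
  | empty => simp
  | insert i s hi ih =>
    have has : ∀ j ∈ s, ‖a j‖ ≤ 1 := fun j hj => ha j (mem_insert_of_mem hj)
    have hbs : ∀ j ∈ s, ‖b j‖ ≤ 1 := fun j hj => hb j (mem_insert_of_mem hj)
    have hPa : ‖∏ j ∈ s, a j‖ ≤ 1 := by
      rw [norm_prod]; exact prod_le_one (fun _ _ => norm_nonneg _) has
    rw [prod_insert hi, prod_insert hi, sum_insert hi]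
    have : a i * ∏ j ∈ s, a j - b i * ∏ j ∈ s, b j =
        (a i - b i) * ∏ j ∈ s, a j + b i * (∏ j ∈ s, a j - ∏ j ∈ s, b j) := by ring
    rw [this]
    refine (norm_add_le _ _).trans (add_le_add ?_ ?_)
    · rw [norm_mul]; exact mul_le_of_le_one_right (norm_nonneg _) hPa
    · rw [norm_mul]
      exact (mul_le_of_le_one_left (norm_nonneg _) (hb i (mem_insert_self _ _))).trans (ih has hbs)

/-- The multiplicative function `ζ ^ #{r ∈ R : r ∣ n}`, as a product over `R`. -/
def primeTwist (R : Finset ℕ) (ζ : ℂ) (n : ℕ) : ℂ :=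
  ∏ r ∈ R, (1 + if r ∣ n then ζ - 1 else 0)

/-- The mean value of `primeTwist R ζ`. -/
noncomputable def primeTwistMean (R : Finset ℕ) (ζ : ℂ) : ℂ :=
  ∏ r ∈ R, (1 + (ζ - 1) / r)

open Finset in
theorem primeTwist_eq_pow (R : Finset ℕ) (ζ : ℂ) (n : ℕ) :
    primeTwist R ζ n = ζ ^ #{r ∈ R | r ∣ n} := by
  rw [primeTwist, ← prod_const, prod_filter]
  refine prod_congr rfl fun r _ => ?_
  split_ifs <;> ring

theorem norm_one_add_ite_le {ζ : ℂ} (hζ : ‖ζ‖ = 1) (P : Prop) [Decidable P] :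
    ‖1 + if P then ζ - 1 else 0‖ ≤ 1 := by
  split_ifs
  · rw [add_sub_cancel, hζ]
  · simp

theorem norm_primeTwist_le (R : Finset ℕ) {ζ : ℂ} (hζ : ‖ζ‖ = 1) (n : ℕ) :
    ‖primeTwist R ζ n‖ ≤ 1 := by
  rw [primeTwist_eq_pow, norm_pow, hζ, one_pow]

theorem norm_sub_one_le_two {ζ : ℂ} (hζ : ‖ζ‖ = 1) : ‖ζ - 1‖ ≤ 2 := by
  refine (norm_sub_le _ _).trans ?_
  rw [hζ, norm_one]; norm_num

theorem norm_one_add_div_natCast_le {ζ : ℂ} (hζ : ‖ζ‖ = 1) {r : ℕ} (hr : 1 ≤ r) :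
    ‖1 + (ζ - 1) / r‖ ≤ 1 := by
  have hr0 : (r : ℂ) ≠ 0 := by exact_mod_cast (by omega : r ≠ 0)
  have hr1 : (1 : ℝ) ≤ r := by exact_mod_cast hr
  have h : 1 + (ζ - 1) / r = ((r - 1 : ℝ) + ζ) / r := by
    push_cast
    field_simp
    ring
  rw [h, norm_div, RCLike.norm_natCast, div_le_one (by linarith)]
  refine (norm_add_le _ _).trans ?_
  rw [hζ, Complex.norm_real, Real.norm_of_nonneg (by linarith)]
  linarith

open Finset in
theorem norm_primeTwistMean_le {R : Finset ℕ} (hR : ∀ r ∈ R, r.Prime) {ζ : ℂ} (hζ : ‖ζ‖ = 1) :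
    ‖primeTwistMean R ζ‖ ≤ 1 := by
  rw [primeTwistMean, norm_prod]
  exact prod_le_one (fun _ _ => norm_nonneg _) fun r hr =>
    norm_one_add_div_natCast_le hζ (hR r hr).one_le

open Finset in
theorem sum_range_ite_dvd_linear {R : Type*} [AddCommMonoid R] {r a : ℕ} (hr : r.Prime)
    (ha : ¬ r ∣ a) (t : ℕ) (c : R) :
    ∑ m ∈ range r, (if r ∣ a * (m + 1) + t then c else 0) = c := by
  have hinj : Set.InjOn (fun m => (a * (m + 1) + t) % r) (range r : Finset ℕ) := by
    intro m hm m' hm' h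
    have h1 : a * (m + 1) + t ≡ a * (m' + 1) + t [MOD r] := h
    have h2 := Nat.ModEq.add_right_cancel' t h1
    have h3 := Nat.ModEq.cancel_left_of_coprime ((Nat.Prime.coprime_iff_not_dvd hr).2 ha) h2
    have h4 := Nat.ModEq.add_right_cancel' 1 h3
    exact Nat.ModEq.eq_of_lt_of_lt h4 (mem_range.1 hm) (mem_range.1 hm')
  have himg : (range r).image (fun m => (a * (m + 1) + t) % r) = range r := by
    refine eq_of_subset_of_card_le ?_ (by rw [card_image_of_injOn hinj])
    intro j hj
    obtain ⟨m, -, rfl⟩ := mem_image.1 hj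
    exact mem_range.2 (Nat.mod_lt _ hr.pos)
  have h : ∑ m ∈ range r, (if r ∣ a * (m + 1) + t then c else 0) =
      ∑ j ∈ range r, if j = 0 then c else 0 := by
    conv_rhs => rw [← himg, sum_image hinj]
    exact sum_congr rfl fun m _ => by simp only [Nat.dvd_iff_mod_eq_zero]
  rw [h, sum_ite_eq' (range r) 0 (fun _ => c), if_pos (mem_range.2 hr.pos)]

theorem periodic_ite_dvd_linear {R : Type*} (r a t : ℕ) (c d : R) :
    Function.Periodic (fun m : ℕ => if r ∣ a * (m + 1) + t then c else d) r := by
  intro m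
  have : a * (m + r + 1) + t = (a * (m + 1) + t) + r * a := by ring
  simp only [this, Nat.dvd_add_left (Dvd.intro a rfl)]

/-- The error term for counting sieved linear forms on an interval of length `M`. -/
noncomputable def sieveError (R : Finset ℕ) (z K M : ℕ) : ℝ :=
  2 * M * ((4 * ∑ r ∈ R, (1 : ℝ) / r) ^ K / K.factorial) + 2 * (K + 1) * (2 * (z : ℝ) ^ 2) ^ K

open Finset in
theorem norm_sum_primeTwist_linear_sub_le {R : Finset ℕ} {z : ℕ} (hR : ∀ r ∈ R, r.Prime)
    (hz : ∀ r ∈ R, r ≤ z) (hz1 : 1 ≤ z) {ζ : ℂ} (hζ : ‖ζ‖ = 1) {a : ℕ}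
    (ha : ∀ r ∈ R, ¬ r ∣ a) (t K M : ℕ) :
    ‖∑ m ∈ range M, primeTwist R ζ (a * (m + 1) + t) - (M : ℂ) * primeTwistMean R ζ‖ ≤
      sieveError R z K M := by
  have h := norm_sum_prod_one_add_sub_le hR hz hz1
    (X := fun r m => if r ∣ a * (m + 1) + t then ζ - 1 else 0)
    (fun r _ => periodic_ite_dvd_linear r a t _ _) (fun r _ m => norm_one_add_ite_le hζ _) K M
  have hm : ∏ r ∈ R, (1 + (∑ m ∈ range r, if r ∣ a * (m + 1) + t then ζ - 1 else 0) / (r : ℂ)) =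
      primeTwistMean R ζ :=
    prod_congr rfl fun r hr => by rw [sum_range_ite_dvd_linear (hR r hr) (ha r hr)]
  rw [hm] at h
  refine h.trans ?_
  rw [sieveError]
  gcongr
  rw [mul_sum]
  refine sum_le_sum fun r hr => ?_
  rw [mul_one_div]
  gcongr
  have : ∀ m, ‖if r ∣ a * (m + 1) + t then ζ - 1 else 0‖ =
      if r ∣ a * (m + 1) + t then ‖ζ - 1‖ else 0 := fun m => by split_ifs <;> simp
  simp only [this]
  rw [sum_range_ite_dvd_linear (hR r hr) (ha r hr)]
  linarith [norm_sub_one_le_two hζ]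

open Finset in
theorem norm_sum_primeTwist_mul_conj_sub_le {R : Finset ℕ} {z : ℕ} (hR : ∀ r ∈ R, r.Prime)
    (hz : ∀ r ∈ R, r ≤ z) (hz1 : 1 ≤ z) {ζ : ℂ} (hζ : ‖ζ‖ = 1) {a b t : ℕ}
    (ha : ∀ r ∈ R, ¬ r ∣ a) (hb : ∀ r ∈ R, ¬ r ∣ b) (ht : ∀ r ∈ R, ¬ r ∣ t)
    (hab : ∀ r ∈ R, ¬ (r : ℤ) ∣ (a : ℤ) - b) (K M : ℕ) :
    ‖∑ m ∈ range M, primeTwist R ζ (a * (m + 1) + t) *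
        (starRingEnd ℂ) (primeTwist R ζ (b * (m + 1) + t)) -
      (M : ℂ) * ∏ r ∈ R, (1 + (ζ - 1 + (starRingEnd ℂ) (ζ - 1)) / r)‖ ≤
      sieveError R z K M := by
  set cj := starRingEnd ℂ
  set X : ℕ → ℕ → ℂ := fun r m => (if r ∣ a * (m + 1) + t then ζ - 1 else 0) +
    if r ∣ b * (m + 1) + t then cj (ζ - 1) else 0 with hXdef
  have hprod : ∀ r ∈ R, ∀ m, 1 + X r m =
      (1 + if r ∣ a * (m + 1) + t then ζ - 1 else 0) *
        cj (1 + if r ∣ b * (m + 1) + t then ζ - 1 else 0) := by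
    intro r hr m
    have hnot : ¬ (r ∣ a * (m + 1) + t ∧ r ∣ b * (m + 1) + t) := by
      rintro ⟨h1, h2⟩
      have h1' : (r : ℤ) ∣ a * (m + 1) + t := by exact_mod_cast h1
      have h2' : (r : ℤ) ∣ b * (m + 1) + t := by exact_mod_cast h2
      have h3 := dvd_sub h1' h2'
      have h4 : (a : ℤ) * (m + 1) + t - (b * (m + 1) + t) = (a - b) * ((m + 1 : ℕ) : ℤ) := by
        push_cast; ring
      rw [h4] at h3
      rcases (Nat.prime_iff_prime_int.1 (hR r hr)).dvd_or_dvd h3 with h5 | h5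
      · exact hab r hr h5
      · have h6 : r ∣ m + 1 := by exact_mod_cast h5
        exact ht r hr ((Nat.dvd_add_right (h6.mul_left a)).1 h1)
    simp only [hXdef]
    by_cases h1 : r ∣ a * (m + 1) + t <;> by_cases h2 : r ∣ b * (m + 1) + t
    · exact absurd ⟨h1, h2⟩ hnot
    all_goals simp [h1, h2]
  have h := norm_sum_prod_one_add_sub_le hR hz hz1 (X := X)
    (fun r _ => (periodic_ite_dvd_linear r a t _ _).add (periodic_ite_dvd_linear r b t _ _))
    (fun r hr m => by
      rw [hprod r hr m, norm_mul, RCLike.norm_conj]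
      exact mul_le_one₀ (norm_one_add_ite_le hζ _) (norm_nonneg _) (norm_one_add_ite_le hζ _)) K M
  have hs : ∀ m, ∏ r ∈ R, (1 + X r m) = primeTwist R ζ (a * (m + 1) + t) *
        cj (primeTwist R ζ (b * (m + 1) + t)) := by
    intro m
    rw [primeTwist, primeTwist, map_prod, ← prod_mul_distrib]
    exact prod_congr rfl fun r hr => hprod r hr m
  simp only [hs] at h
  have hm : ∏ r ∈ R, (1 + (∑ m ∈ range r, X r m) / (r : ℂ)) =
      ∏ r ∈ R, (1 + (ζ - 1 + cj (ζ - 1)) / r) :=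
    prod_congr rfl fun r hr => by
      simp only [hXdef]
      rw [sum_add_distrib, sum_range_ite_dvd_linear (hR r hr) (ha r hr),
        sum_range_ite_dvd_linear (hR r hr) (hb r hr)]
  rw [hm] at h
  refine h.trans ?_
  rw [sieveError]
  gcongr
  rw [mul_sum]
  refine sum_le_sum fun r hr => ?_
  rw [mul_one_div]
  gcongr
  have : ∀ m, ‖X r m‖ ≤ (if r ∣ a * (m + 1) + t then ‖ζ - 1‖ else 0) +
      if r ∣ b * (m + 1) + t then ‖ζ - 1‖ else 0 := fun m => by
    simp only [hXdef]
    refine (norm_add_le _ _).trans (le_of_eq ?_)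
    split_ifs <;> simp [cj, -map_sub]
  refine (sum_le_sum fun m _ => this m).trans ?_
  rw [sum_add_distrib, sum_range_ite_dvd_linear (hR r hr) (ha r hr),
    sum_range_ite_dvd_linear (hR r hr) (hb r hr)]
  linarith [norm_sub_one_le_two hζ]

open Finset in
/-- The centred twists along two distinct dilations are nearly orthogonal. -/
theorem norm_sum_centred_primeTwist_mul_conj_le {R : Finset ℕ} {z : ℕ} (hR : ∀ r ∈ R, r.Prime)
    (hz : ∀ r ∈ R, r ≤ z) (hz1 : 1 ≤ z) {ζ : ℂ} (hζ : ‖ζ‖ = 1) {a b t : ℕ}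
    (ha : ∀ r ∈ R, ¬ r ∣ a) (hb : ∀ r ∈ R, ¬ r ∣ b) (ht : ∀ r ∈ R, ¬ r ∣ t)
    (hab : ∀ r ∈ R, ¬ (r : ℤ) ∣ (a : ℤ) - b) (K M : ℕ) :
    ‖∑ m ∈ range M, (primeTwist R ζ (a * (m + 1) + t) - primeTwistMean R ζ) *
        (starRingEnd ℂ) (primeTwist R ζ (b * (m + 1) + t) - primeTwistMean R ζ)‖ ≤
      3 * sieveError R z K M + 4 * M * ∑ r ∈ R, (1 : ℝ) / (r : ℝ) ^ 2 := by
  have hA := norm_sum_primeTwist_linear_sub_le hR hz hz1 hζ ha t K M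
  have hB := norm_sum_primeTwist_linear_sub_le hR hz hz1 hζ hb t K M
  have hAB := norm_sum_primeTwist_mul_conj_sub_le hR hz hz1 hζ ha hb ht hab K M
  have hμ := norm_primeTwistMean_le hR hζ
  set cj := starRingEnd ℂ
  set μ := primeTwistMean R ζ with hμdef
  set P := ∏ r ∈ R, (1 + (ζ - 1 + cj (ζ - 1)) / (r : ℂ)) with hP
  have hPμ : ‖P - μ * cj μ‖ ≤ 4 * ∑ r ∈ R, (1 : ℝ) / (r : ℝ) ^ 2 := by
    have hμμ : μ * cj μ = ∏ r ∈ R, ((1 + (ζ - 1) / (r : ℂ)) * cj (1 + (ζ - 1) / (r : ℂ))) := by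
      rw [hμdef, primeTwistMean, map_prod, ← prod_mul_distrib]
    rw [hP, hμμ]
    have hone : ∀ r ∈ R, ‖(1 + (ζ - 1) / (r : ℂ)) * cj (1 + (ζ - 1) / (r : ℂ))‖ ≤ 1 := by
      intro r hr
      rw [norm_mul, RCLike.norm_conj]
      have := norm_one_add_div_natCast_le hζ (hR r hr).one_le
      exact mul_le_one₀ this (norm_nonneg _) this
    refine (norm_prod_sub_prod_le_sum _ _ _ ?_ hone).trans ?_
    · intro r hr
      have hr2 : (2 : ℝ) ≤ r := by exact_mod_cast (hR r hr).two_le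
      have hreal : ζ - 1 + cj (ζ - 1) = ((2 * ζ.re - 2 : ℝ) : ℂ) := by
        rw [Complex.add_conj]; simp; ring
      have hre := Complex.abs_re_le_norm ζ
      rw [hζ, abs_le] at hre
      have hr0 : (0 : ℝ) < r := by linarith
      have : (1 : ℂ) + (ζ - 1 + cj (ζ - 1)) / r = ((1 + (2 * ζ.re - 2) / r : ℝ) : ℂ) := by
        rw [hreal]; push_cast; ring
      rw [this, Complex.norm_real, Real.norm_eq_abs, abs_le]
      have h1 : (2 * ζ.re - 2) / r ≤ 0 := div_nonpos_of_nonpos_of_nonneg (by linarith) hr0.le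
      have h2 : -2 ≤ (2 * ζ.re - 2) / r := by
        rw [le_div_iff₀ hr0]; nlinarith
      constructor <;> linarith
    · rw [mul_sum]
      refine sum_le_sum fun r hr => ?_
      have : 1 + (ζ - 1 + cj (ζ - 1)) / (r : ℂ) -
          (1 + (ζ - 1) / (r : ℂ)) * cj (1 + (ζ - 1) / (r : ℂ)) =
          -((ζ - 1) * cj (ζ - 1) / (r : ℂ) ^ 2) := by
        have hr0 : (r : ℂ) ≠ 0 := by exact_mod_cast (hR r hr).ne_zero
        rw [map_add, map_one, map_div₀, Complex.conj_natCast]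
        field_simp
        ring
      rw [this, norm_neg, norm_div, norm_mul, RCLike.norm_conj, norm_pow, RCLike.norm_natCast,
        mul_one_div]
      gcongr
      nlinarith [norm_sub_one_le_two hζ, norm_nonneg (ζ - 1)]
  have hsplit : ∑ m ∈ range M, (primeTwist R ζ (a * (m + 1) + t) - μ) *
        cj (primeTwist R ζ (b * (m + 1) + t) - μ) =
      (∑ m ∈ range M, primeTwist R ζ (a * (m + 1) + t) * cj (primeTwist R ζ (b * (m + 1) + t))
        - M * P)
      - cj μ * (∑ m ∈ range M, primeTwist R ζ (a * (m + 1) + t) - M * μ)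
      - μ * cj (∑ m ∈ range M, primeTwist R ζ (b * (m + 1) + t) - M * μ)
      + M * (P - μ * cj μ) := by
    have : ∀ m, (primeTwist R ζ (a * (m + 1) + t) - μ) *
        cj (primeTwist R ζ (b * (m + 1) + t) - μ) =
        primeTwist R ζ (a * (m + 1) + t) * cj (primeTwist R ζ (b * (m + 1) + t))
        - cj μ * primeTwist R ζ (a * (m + 1) + t) - μ * cj (primeTwist R ζ (b * (m + 1) + t))
        + μ * cj μ := fun m => by rw [map_sub]; ring
    simp only [this]
    rw [sum_add_distrib, sum_sub_distrib, sum_sub_distrib, ← mul_sum, ← mul_sum, map_sub, map_sum,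
      map_mul, Complex.conj_natCast]
    simp
    ring
  rw [hsplit]
  have e1 : ‖cj μ * (∑ m ∈ range M, primeTwist R ζ (a * (m + 1) + t) - M * μ)‖ ≤
      sieveError R z K M := by
    rw [norm_mul, RCLike.norm_conj]
    exact (mul_le_of_le_one_left (norm_nonneg _) hμ).trans hA
  have e2 : ‖μ * cj (∑ m ∈ range M, primeTwist R ζ (b * (m + 1) + t) - M * μ)‖ ≤
      sieveError R z K M := by
    rw [norm_mul, RCLike.norm_conj]
    exact (mul_le_of_le_one_left (norm_nonneg _) hμ).trans hB
  have e3 : ‖(M : ℂ) * (P - μ * cj μ)‖ ≤ 4 * M * ∑ r ∈ R, (1 : ℝ) / (r : ℝ) ^ 2 := by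
    rw [norm_mul, RCLike.norm_natCast]
    have := mul_le_mul_of_nonneg_left hPμ (Nat.cast_nonneg M)
    linarith
  refine (norm_add_le _ _).trans ?_
  refine (add_le_add_left (norm_sub_le _ _) _).trans ?_
  refine (add_le_add_left (add_le_add_left (norm_sub_le _ _) _) _).trans ?_
  linarith

open Finset in
theorem sum_Icc_one_eq_sum_range {R : Type*} [AddCommMonoid R] (f : ℕ → R) (N : ℕ) :
    ∑ n ∈ Icc 1 N, f n = ∑ m ∈ range N, f (m + 1) := by
  rw [← Ico_succ_right_eq_Icc, sum_Ico_eq_sum_range]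
  simp [add_comm]

open Finset in
/-- The **Turán–Kubilius inequality** for the number of prime divisors from a finite set. -/
theorem sum_sq_card_dvd_sub_le {S : Finset ℕ} {z : ℕ} (hS : ∀ p ∈ S, p.Prime)
    (hz : ∀ p ∈ S, p ≤ z) (t N : ℕ) :
    ∑ n ∈ Icc 1 N, ((#{p ∈ S | p ∣ n + t} : ℝ) - ∑ p ∈ S, (1 : ℝ) / p) ^ 2 ≤
      N * ∑ p ∈ S, (1 : ℝ) / p + 12 * (z : ℝ) ^ 4 := by
  rw [sum_Icc_one_eq_sum_range]
  set Y : ℕ → ℕ → ℝ := fun p m => (if p ∣ 1 * (m + 1) + t then 1 else 0) - 1 / (p : ℝ) with hY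
  have hper : ∀ p, Function.Periodic (Y p) p := fun p m => by
    have := periodic_ite_dvd_linear (R := ℝ) p 1 t 1 0 m
    exact congrArg (· - 1 / (p : ℝ)) this
  have hYb : ∀ p ∈ S, ∀ m, |Y p m| ≤ 1 := fun p hp m => by
    have h1 : (1 : ℝ) ≤ p := by exact_mod_cast (hS p hp).one_le
    have h2 : 1 / (p : ℝ) ≤ 1 := by rw [div_le_one (by linarith)]; exact h1
    have h3 : 0 ≤ 1 / (p : ℝ) := by positivity
    simp only [hY]
    split_ifs <;> rw [abs_le] <;> constructor <;> linarith
  have hnd : ∀ p ∈ S, ¬ p ∣ 1 := fun p hp h => (hS p hp).one_lt.ne' (Nat.dvd_one.1 h)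
  have hY0 : ∀ p ∈ S, ∑ m ∈ range p, Y p m = 0 := fun p hp => by
    have h0 : (p : ℝ) ≠ 0 := by exact_mod_cast (hS p hp).ne_zero
    simp only [hY]
    rw [sum_sub_distrib, sum_range_ite_dvd_linear (hS p hp) (hnd p hp)]
    simp [h0]
  have hsum : ∀ m, (#{p ∈ S | p ∣ m + 1 + t} : ℝ) - ∑ p ∈ S, (1 : ℝ) / p = ∑ p ∈ S, Y p m := by
    intro m
    simp only [hY]
    rw [sum_sub_distrib, ← sum_boole]
    simp
  have hoff : ∀ p ∈ S, ∀ q ∈ S, p ≠ q → ∑ m ∈ range N, Y p m * Y q m ≤ 8 * (z : ℝ) ^ 2 := by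
    intro p hp q hq hpq
    have hmem : ∀ r ∈ ({p, q} : Finset ℕ), r ∈ S := by
      intro r hr
      rcases mem_insert.1 hr with rfl | hr
      · exact hp
      · rw [mem_singleton.1 hr]; exact hq
    have h := norm_sum_range_prod_sub_le (𝕜 := ℝ) (X := Y) (D := {p, q}) (z := z)
      (fun r hr => hS r (hmem r hr)) (fun r hr => hz r (hmem r hr)) (fun r _ => hper r)
      (fun r hr m => by rw [Real.norm_eq_abs]; linarith [hYb r (hmem r hr) m]) N
    simp only [prod_pair hpq, hY0 p hp, hY0 q hq, card_pair hpq] at h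
    have h' := (le_abs_self _).trans h
    simp only [zero_div, mul_zero, sub_zero] at h'
    linarith
  have hdiag : ∀ p ∈ S, ∑ m ∈ range N, Y p m * Y p m ≤ N * (1 / (p : ℝ)) + 4 * z := by
    intro p hp
    have h0 : (p : ℝ) ≠ 0 := by exact_mod_cast (hS p hp).ne_zero
    have h1 : (1 : ℝ) ≤ p := by exact_mod_cast (hS p hp).one_le
    have h := norm_sum_range_sub_le_of_periodic (𝕜 := ℝ) (hS p hp).pos ((hper p).mul (hper p))
      (B := 1) (fun m => by
        rw [Pi.mul_apply, norm_mul, Real.norm_eq_abs]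
        exact mul_le_one₀ (hYb p hp m) (abs_nonneg _) (hYb p hp m)) N
    have h' := (le_abs_self _).trans h
    simp only [Pi.mul_apply] at h'
    have hsq : ∑ m ∈ range p, Y p m * Y p m ≤ 1 := by
      have : ∀ m, Y p m * Y p m = (1 - 2 / p) * (if p ∣ 1 * (m + 1) + t then 1 else 0) +
          1 / (p : ℝ) ^ 2 := fun m => by
        simp only [hY]
        split_ifs <;> field_simp <;> ring
      simp only [this]
      rw [sum_add_distrib, ← mul_sum, sum_range_ite_dvd_linear (hS p hp) (hnd p hp)]
      simp only [sum_const, card_range, nsmul_eq_mul]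
      have : (p : ℝ) * (1 / (p : ℝ) ^ 2) = 1 / p := by field_simp
      rw [this]
      have : 0 ≤ 1 / (p : ℝ) := by positivity
      have h2 : (2 : ℝ) / p = 2 * (1 / p) := by ring
      linarith
    have h3 : (N : ℝ) * ((∑ m ∈ range p, Y p m * Y p m) / p) ≤ N * (1 / p) := by gcongr
    have h4 : (p : ℝ) ≤ z := by exact_mod_cast hz p hp
    linarith
  have hSz : (#S : ℝ) ≤ z := by
    have h1 : S ⊆ Icc 1 z := fun p hp => mem_Icc.2 ⟨(hS p hp).one_le, hz p hp⟩
    have := card_le_card h1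
    rw [Nat.card_Icc] at this
    exact_mod_cast this
  have hrow : ∀ p ∈ S, ∑ q ∈ S, ∑ m ∈ range N, Y p m * Y q m ≤
      N * (1 / (p : ℝ)) + 4 * z + z * (8 * (z : ℝ) ^ 2) := by
    intro p hp
    rw [← add_sum_erase S _ hp]
    refine add_le_add (hdiag p hp) ?_
    refine (sum_le_sum fun q hq => hoff p hp q (mem_of_mem_erase hq) (ne_of_mem_erase hq).symm).trans ?_
    rw [sum_const, nsmul_eq_mul]
    have : (#(S.erase p) : ℝ) ≤ z :=
      le_trans (by exact_mod_cast card_le_card (erase_subset p S)) hSz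
    gcongr
  simp only [hsum, sq, sum_mul_sum]
  rw [sum_comm]
  have : ∀ p ∈ S, ∑ m ∈ range N, ∑ q ∈ S, Y p m * Y q m ≤
      N * (1 / (p : ℝ)) + 4 * z + z * (8 * (z : ℝ) ^ 2) := fun p hp => by
    rw [sum_comm]; exact hrow p hp
  refine (sum_le_sum this).trans ?_
  rw [sum_add_distrib, sum_add_distrib, ← mul_sum, sum_const, sum_const, nsmul_eq_mul, nsmul_eq_mul]
  rcases Nat.eq_zero_or_pos z with rfl | hzpos
  · simp
  · have hz1 : (1 : ℝ) ≤ z := by exact_mod_cast hzpos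
    have e1 : (#S : ℝ) * (4 * z) ≤ z * (4 * z) := by gcongr
    have e2 : (#S : ℝ) * (z * (8 * (z : ℝ) ^ 2)) ≤ z * (z * (8 * (z : ℝ) ^ 2)) := by gcongr
    have e3 : (z : ℝ) ^ 2 ≤ (z : ℝ) ^ 4 := pow_le_pow_right₀ hz1 (by norm_num)
    nlinarith

open Finset in
theorem card_multiples_le {d : ℕ} (N : ℕ) :
    (#{n ∈ Icc 1 N | d ∣ n} : ℝ) ≤ N / d := by
  have h : #{n ∈ Icc 1 N | d ∣ n} = N / d := by
    rw [← Nat.Ioc_filter_dvd_card_eq_div]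
    congr 1
  rw [h]
  exact Nat.cast_div_le

open Finset in
theorem sum_card_dvd_le (S : Finset ℕ) (N : ℕ) :
    ∑ n ∈ Icc 1 N, (#{p ∈ S | p ∣ n} : ℝ) ≤ N * ∑ p ∈ S, (1 : ℝ) / p := by
  have h : ∀ n ∈ Icc 1 N, (#{p ∈ S | p ∣ n} : ℝ) = ∑ p ∈ S, if p ∣ n then 1 else 0 := by
    intro n _; rw [sum_boole]
  rw [sum_congr rfl h, sum_comm, mul_sum]
  refine sum_le_sum fun p _ => ?_
  rw [sum_boole, mul_one_div]
  exact card_multiples_le N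

open Finset in
theorem sum_inv_sq_prime_le {S : Finset ℕ} (hS : ∀ p ∈ S, p.Prime) :
    ∑ p ∈ S, (1 : ℝ) / (p : ℝ) ^ 2 ≤ 1 := by
  have hsub : S ⊆ Ioo 1 (S.sup id + 1) := fun p hp =>
    mem_Ioo.2 ⟨(hS p hp).one_lt, Nat.lt_succ_of_le (le_sup (f := id) hp)⟩
  have h := sum_Ioo_inv_sq_le (α := ℝ) 1 (S.sup id + 1)
  norm_num at h
  refine le_trans ?_ h
  simp only [one_div]
  exact sum_le_sum_of_subset_of_nonneg hsub fun _ _ _ => by positivity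

open Finset in
theorem sum_offDiag_dvd_eq {S : Finset ℕ} (hS : ∀ p ∈ S, p.Prime) (n : ℕ) :
    (#{i ∈ S.offDiag | i.1 * i.2 ∣ n} : ℝ) =
      (#{p ∈ S | p ∣ n} : ℝ) * ((#{p ∈ S | p ∣ n} : ℝ) - 1) := by
  have h : {i ∈ S.offDiag | i.1 * i.2 ∣ n} = ({p ∈ S | p ∣ n}).offDiag := by
    ext ⟨p, q⟩
    simp only [mem_filter, mem_offDiag]
    constructor
    · rintro ⟨⟨hp, hq, hpq⟩, hd⟩
      exact ⟨⟨hp, (dvd_mul_right _ _).trans hd⟩, ⟨hq, (dvd_mul_left _ _).trans hd⟩, hpq⟩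
    · rintro ⟨⟨hp, hpn⟩, ⟨hq, hqn⟩, hpq⟩
      exact ⟨⟨hp, hq, hpq⟩,
        ((Nat.coprime_primes (hS p hp) (hS q hq)).2 hpq).mul_dvd_of_dvd_of_dvd hpn hqn⟩
  rw [h, offDiag_card, Nat.cast_sub (Nat.le_mul_self _)]
  push_cast
  ring

open Finset in
theorem sum_offDiag_inv_mul_le (S : Finset ℕ) :
    ∑ i ∈ S.offDiag, (1 : ℝ) / (i.1 * i.2 : ℕ) ≤ (∑ p ∈ S, (1 : ℝ) / p) ^ 2 := by
  have h : ∀ i : ℕ × ℕ, (1 : ℝ) / (i.1 * i.2 : ℕ) = 1 / i.1 * (1 / i.2) := fun i => by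
    push_cast
    rw [one_div_mul_one_div]
  simp only [h]
  rw [sq, sum_mul_sum, ← sum_product']
  refine sum_le_sum_of_subset_of_nonneg (fun i hi => ?_) fun _ _ _ => by positivity
  rw [mem_offDiag] at hi
  exact mem_product.2 ⟨hi.1, hi.2.1⟩

open Finset in
theorem sum_abs_card_mul_sub_sq_le {S : Finset ℕ} (N : ℕ) {L V : ℝ}
    (hL : L = ∑ p ∈ S, (1 : ℝ) / p)
    (hV : ∑ n ∈ Icc 1 N, ((#{p ∈ S | p ∣ n} : ℝ) - L) ^ 2 ≤ V) :
    ∑ n ∈ Icc 1 N, |(#{p ∈ S | p ∣ n} : ℝ) * ((#{p ∈ S | p ∣ n} : ℝ) - 1) - L ^ 2| ≤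
      V + 2 * L * Real.sqrt (N * V) + N * L := by
  have hL0 : 0 ≤ L := by rw [hL]; positivity
  have hpt : ∀ n ∈ Icc 1 N,
      |(#{p ∈ S | p ∣ n} : ℝ) * ((#{p ∈ S | p ∣ n} : ℝ) - 1) - L ^ 2| ≤
      ((#{p ∈ S | p ∣ n} : ℝ) - L) ^ 2 + 2 * L * |(#{p ∈ S | p ∣ n} : ℝ) - L| +
        (#{p ∈ S | p ∣ n} : ℝ) := by
    intro n _
    set w := (#{p ∈ S | p ∣ n} : ℝ)
    have hw : 0 ≤ w := by positivity
    have h : w * (w - 1) - L ^ 2 = (w - L) ^ 2 + 2 * L * (w - L) - w := by ring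
    rw [h]
    refine (abs_sub _ _).trans ?_
    refine add_le_add ((abs_add_le _ _).trans (le_of_eq ?_)) (abs_of_nonneg hw).le
    rw [abs_of_nonneg (sq_nonneg _), abs_mul, abs_of_nonneg (by positivity : 0 ≤ 2 * L)]
  refine (sum_le_sum hpt).trans ?_
  rw [sum_add_distrib, sum_add_distrib, ← mul_sum]
  have h1 : ∑ n ∈ Icc 1 N, |(#{p ∈ S | p ∣ n} : ℝ) - L| ≤ Real.sqrt (N * V) := by
    apply Real.le_sqrt_of_sq_le
    refine (sq_sum_le_card_mul_sum_sq).trans ?_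
    simp only [sq_abs, Nat.card_Icc, add_tsub_cancel_right]
    gcongr
  have h2 := sum_card_dvd_le S N
  rw [← hL] at h2
  have h3 := mul_le_mul_of_nonneg_left h1 (by positivity : 0 ≤ 2 * L)
  linarith

open Finset in
theorem sum_multiples_eq {R : Type*} [AddCommMonoid R] {a : ℕ} (ha : 0 < a) (N : ℕ) (f : ℕ → R) :
    ∑ n ∈ Icc 1 N with a ∣ n, f n = ∑ m ∈ Icc 1 (N / a), f (a * m) := by
  symm
  refine sum_bij (fun m _ => a * m) ?_ ?_ ?_ ?_
  · intro m hm
    rw [mem_Icc] at hm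
    rw [mem_filter, mem_Icc]
    refine ⟨⟨Nat.mul_pos ha hm.1, ?_⟩, dvd_mul_right _ _⟩
    rw [mul_comm]
    exact (Nat.le_div_iff_mul_le ha).1 hm.2
  · intro m _ m' _ h
    exact Nat.eq_of_mul_eq_mul_left ha h
  · intro n hn
    rw [mem_filter, mem_Icc] at hn
    obtain ⟨⟨h1, h2⟩, m, rfl⟩ := hn
    refine ⟨m, mem_Icc.2 ⟨Nat.pos_of_mul_pos_left h1, ?_⟩, rfl⟩
    rw [Nat.le_div_iff_mul_le ha, mul_comm]
    exact h2
  · intro m _; rfl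

open Finset in
theorem sum_mul_card_offDiag_eq {S : Finset ℕ} (hS : ∀ p ∈ S, p.Prime) (N : ℕ) (f : ℕ → ℂ) :
    ∑ n ∈ Icc 1 N, (#{i ∈ S.offDiag | i.1 * i.2 ∣ n} : ℂ) * f n =
      ∑ i ∈ S.offDiag, ∑ m ∈ Icc 1 (N / (i.1 * i.2)), f (i.1 * i.2 * m) := by
  have h : ∀ n ∈ Icc 1 N, (#{i ∈ S.offDiag | i.1 * i.2 ∣ n} : ℂ) * f n =
      ∑ i ∈ S.offDiag, if i.1 * i.2 ∣ n then f n else 0 := by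
    intro n _
    rw [← sum_boole, sum_mul]
    exact sum_congr rfl fun i _ => by split_ifs <;> simp
  rw [sum_congr rfl h, sum_comm]
  refine sum_congr rfl fun i hi => ?_
  rw [mem_offDiag] at hi
  rw [← sum_filter, sum_multiples_eq (Nat.mul_pos (hS _ hi.1).pos (hS _ hi.2.1).pos)]

theorem card_divisors_prime_mul_prime_mul {p q m : ℕ} (hp : p.Prime) (hq : q.Prime) (hpq : p ≠ q)
    (hpm : ¬ p ∣ m) (hqm : ¬ q ∣ m) :
    (p * q * m).divisors.card = 4 * m.divisors.card := by
  have hc1 : p.Coprime m := (Nat.Prime.coprime_iff_not_dvd hp).2 hpm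
  have hc2 : q.Coprime m := (Nat.Prime.coprime_iff_not_dvd hq).2 hqm
  have hc3 : p.Coprime q := (Nat.coprime_primes hp hq).2 hpq
  rw [Nat.Coprime.card_divisors_mul (Nat.Coprime.mul_left hc1 hc2), hc3.card_divisors_mul,
    hp.divisors, hq.divisors, Finset.card_pair hp.one_lt.ne, Finset.card_pair hq.one_lt.ne]

open Finset in
theorem card_filter_prime_mul_eq_le {S : Finset ℕ} (hS : ∀ p ∈ S, p.Prime) {i : ℕ × ℕ}
    (hi : i ∈ S.offDiag) : #{j ∈ S.offDiag | i.1 * i.2 = j.1 * j.2} ≤ 2 := by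
  refine (card_le_card (t := {(i.1, i.2), (i.2, i.1)}) fun j hj => ?_).trans card_le_two
  rw [mem_filter, mem_offDiag] at hj
  rw [mem_offDiag] at hi
  obtain ⟨⟨h1, h2, h12⟩, he⟩ := hj
  have hp1 := hS _ h1
  have hp2 := hS _ h2
  have hq1 := hS _ hi.1
  have hq2 := hS _ hi.2.1
  have hd : j.1 ∣ i.1 * i.2 := he ▸ dvd_mul_right _ _
  rw [mem_insert, mem_singleton]
  rcases (Nat.Prime.dvd_mul hp1).1 hd with h | h
  · have e := (Nat.prime_dvd_prime_iff_eq hp1 hq1).1 h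
    rw [← e] at he
    left
    rw [← e, Nat.eq_of_mul_eq_mul_left hp1.pos he]
  · have e := (Nat.prime_dvd_prime_iff_eq hp1 hq2).1 h
    rw [← e, mul_comm] at he
    right
    rw [← e, Nat.eq_of_mul_eq_mul_left hp1.pos he]

open Finset in
theorem sum_sq_norm_sum_le_of_correlation {S : Finset ℕ} (hS : ∀ p ∈ S, p.Prime) (N : ℕ)
    (h : ℕ → ℂ) (hh : ∀ n, ‖h n‖ ≤ 2) {δ : ℝ} (hδ : 0 ≤ δ)
    (hcorr : ∀ i ∈ S.offDiag, ∀ j ∈ S.offDiag, i.1 * i.2 ≠ j.1 * j.2 →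
      ‖∑ m ∈ Icc 1 (min (N / (i.1 * i.2)) (N / (j.1 * j.2))),
        h (i.1 * i.2 * m) * (starRingEnd ℂ) (h (j.1 * j.2 * m))‖ ≤ δ) :
    ∑ m ∈ Icc 1 N, ‖∑ i ∈ S.offDiag, if m ≤ N / (i.1 * i.2) then h (i.1 * i.2 * m) else 0‖ ^ 2 ≤
      8 * N * (∑ p ∈ S, (1 : ℝ) / p) ^ 2 + (#S : ℝ) ^ 4 * δ := by
  set W : ℕ → ℕ × ℕ → ℂ := fun m i => if m ≤ N / (i.1 * i.2) then h (i.1 * i.2 * m) else 0 with hW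
  have hexp : ((∑ m ∈ Icc 1 N, ‖∑ i ∈ S.offDiag, W m i‖ ^ 2 : ℝ) : ℂ) =
      ∑ i ∈ S.offDiag, ∑ j ∈ S.offDiag, ∑ m ∈ Icc 1 (min (N / (i.1 * i.2)) (N / (j.1 * j.2))),
        h (i.1 * i.2 * m) * (starRingEnd ℂ) (h (j.1 * j.2 * m)) := by
    push_cast
    have h1 : ∀ m, ((‖∑ i ∈ S.offDiag, W m i‖ : ℝ) : ℂ) ^ 2 =
        ∑ i ∈ S.offDiag, ∑ j ∈ S.offDiag, W m i * (starRingEnd ℂ) (W m j) := fun m => by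
      rw [← Complex.mul_conj', map_sum, sum_mul_sum]
    simp only [h1]
    rw [sum_comm]
    refine sum_congr rfl fun i _ => ?_
    rw [sum_comm]
    refine sum_congr rfl fun j _ => ?_
    have hI : Icc 1 (min (N / (i.1 * i.2)) (N / (j.1 * j.2))) =
        {m ∈ Icc 1 N | m ≤ N / (i.1 * i.2) ∧ m ≤ N / (j.1 * j.2)} := by
      ext m
      simp only [mem_Icc, mem_filter, le_min_iff]
      have := Nat.div_le_self N (i.1 * i.2)
      omega
    rw [hI, sum_filter]
    refine sum_congr rfl fun m _ => ?_
    simp only [hW]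
    by_cases h2 : m ≤ N / (i.1 * i.2) <;> by_cases h3 : m ≤ N / (j.1 * j.2) <;> simp [h2, h3]
  have hterm : ∀ i ∈ S.offDiag, ∀ j ∈ S.offDiag,
      ‖∑ m ∈ Icc 1 (min (N / (i.1 * i.2)) (N / (j.1 * j.2))),
        h (i.1 * i.2 * m) * (starRingEnd ℂ) (h (j.1 * j.2 * m))‖ ≤
      (if i.1 * i.2 = j.1 * j.2 then 4 * (N * (1 / ((i.1 * i.2 : ℕ) : ℝ))) else 0) + δ := by
    intro i hi j hj
    split_ifs with hij
    · refine (norm_sum_le _ _).trans ?_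
      have hb : ∀ m ∈ Icc 1 (min (N / (i.1 * i.2)) (N / (j.1 * j.2))),
          ‖h (i.1 * i.2 * m) * (starRingEnd ℂ) (h (j.1 * j.2 * m))‖ ≤ 4 := fun m _ => by
        rw [norm_mul, RCLike.norm_conj]
        nlinarith [hh (i.1 * i.2 * m), hh (j.1 * j.2 * m), norm_nonneg (h (i.1 * i.2 * m)),
          norm_nonneg (h (j.1 * j.2 * m))]
      refine (sum_le_card_nsmul _ _ _ hb).trans ?_
      rw [hij, min_self, Nat.card_Icc, Nat.add_sub_cancel, nsmul_eq_mul]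
      have : ((N / (j.1 * j.2) : ℕ) : ℝ) ≤ N / ((j.1 * j.2 : ℕ) : ℝ) := Nat.cast_div_le
      rw [mul_one_div]
      linarith
    · rw [zero_add]
      exact hcorr i hi j hj hij
  have hcard : (#S.offDiag : ℝ) ≤ (#S : ℝ) ^ 2 := by
    rw [offDiag_card, sq]
    exact_mod_cast Nat.sub_le _ _
  have hrow : ∀ i ∈ S.offDiag, ∑ j ∈ S.offDiag,
      ((if i.1 * i.2 = j.1 * j.2 then 4 * (N * (1 / ((i.1 * i.2 : ℕ) : ℝ))) else 0) + δ) ≤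
      8 * N * (1 / ((i.1 * i.2 : ℕ) : ℝ)) + (#S : ℝ) ^ 2 * δ := by
    intro i hi
    rw [sum_add_distrib, ← sum_filter, sum_const, sum_const, nsmul_eq_mul, nsmul_eq_mul]
    have h2 : (#{j ∈ S.offDiag | i.1 * i.2 = j.1 * j.2} : ℝ) ≤ 2 := by
      exact_mod_cast card_filter_prime_mul_eq_le hS hi
    have h3 : 0 ≤ (N : ℝ) * (1 / ((i.1 * i.2 : ℕ) : ℝ)) := by positivity
    refine add_le_add ?_ (by gcongr)
    nlinarith
  have hnorm : ∑ m ∈ Icc 1 N, ‖∑ i ∈ S.offDiag, W m i‖ ^ 2 =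
      ‖((∑ m ∈ Icc 1 N, ‖∑ i ∈ S.offDiag, W m i‖ ^ 2 : ℝ) : ℂ)‖ := by
    rw [Complex.norm_real, Real.norm_of_nonneg (by positivity)]
  rw [hnorm, hexp]
  refine (norm_sum_le _ _).trans ((sum_le_sum fun i hi => (norm_sum_le _ _).trans
    ((sum_le_sum (hterm i hi)).trans (hrow i hi))).trans ?_)
  rw [sum_add_distrib, ← mul_sum, sum_const, nsmul_eq_mul]
  have h4 := sum_offDiag_inv_mul_le S
  have h5 : (#S.offDiag : ℝ) * ((#S : ℝ) ^ 2 * δ) ≤ (#S : ℝ) ^ 2 * ((#S : ℝ) ^ 2 * δ) := by gcongr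
  have h6 : (8 * N : ℝ) * ∑ i ∈ S.offDiag, 1 / ((i.1 * i.2 : ℕ) : ℝ) ≤
      8 * N * (∑ p ∈ S, (1 : ℝ) / p) ^ 2 := by gcongr
  nlinarith

open Finset in
/-- Replacing `τ(pqm)` by `4τ(m)` in a sum over the multiples of products of two primes. -/
theorem sum_offDiag_norm_sub_le {S : Finset ℕ} (hS : ∀ p ∈ S, p.Prime) (N : ℕ) (g : ℕ → ℕ → ℂ)
    (hg : ∀ t n, ‖g t n‖ ≤ 2) :
    ‖∑ i ∈ S.offDiag, ∑ m ∈ Icc 1 (N / (i.1 * i.2)),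
        g (i.1 * i.2 * m).divisors.card (i.1 * i.2 * m) -
      ∑ i ∈ S.offDiag, ∑ m ∈ Icc 1 (N / (i.1 * i.2)),
        g (4 * m.divisors.card) (i.1 * i.2 * m)‖ ≤ 8 * N * ∑ p ∈ S, (1 : ℝ) / p := by
  rw [← sum_sub_distrib]
  have hterm : ∀ i ∈ S.offDiag, ‖∑ m ∈ Icc 1 (N / (i.1 * i.2)),
        g (i.1 * i.2 * m).divisors.card (i.1 * i.2 * m) -
      ∑ m ∈ Icc 1 (N / (i.1 * i.2)), g (4 * m.divisors.card) (i.1 * i.2 * m)‖ ≤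
      4 * N * (1 / (i.1 : ℝ) ^ 2 * (1 / i.2) + 1 / (i.1 : ℝ) * (1 / (i.2 : ℝ) ^ 2)) := by
    intro i hi
    rw [mem_offDiag] at hi
    rw [← sum_sub_distrib]
    have hpt : ∀ m ∈ Icc 1 (N / (i.1 * i.2)),
        ‖g (i.1 * i.2 * m).divisors.card (i.1 * i.2 * m) -
          g (4 * m.divisors.card) (i.1 * i.2 * m)‖ ≤
        4 * ((if i.1 ∣ m then 1 else 0) + (if i.2 ∣ m then 1 else 0)) := by
      intro m _
      by_cases h1 : i.1 ∣ m ∨ i.2 ∣ m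
      · refine (norm_sub_le _ _).trans ?_
        have := hg (i.1 * i.2 * m).divisors.card (i.1 * i.2 * m)
        have := hg (4 * m.divisors.card) (i.1 * i.2 * m)
        rcases h1 with h | h <;> simp only [h, if_true] <;> split_ifs <;> linarith
      · rw [not_or] at h1
        rw [card_divisors_prime_mul_prime_mul (hS _ hi.1) (hS _ hi.2.1) hi.2.2 h1.1 h1.2, sub_self,
          norm_zero]
        positivity
    refine (norm_sum_le _ _).trans ((sum_le_sum hpt).trans ?_)
    rw [← mul_sum, sum_add_distrib, sum_boole, sum_boole, mul_assoc 4, mul_add (N : ℝ)]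
    have hd : ((N / (i.1 * i.2) : ℕ) : ℝ) ≤ N / ((i.1 * i.2 : ℕ) : ℝ) := Nat.cast_div_le
    have hb : ∀ d : ℕ, (#{m ∈ Icc 1 (N / (i.1 * i.2)) | d ∣ m} : ℝ) ≤
        N / ((i.1 * i.2 : ℕ) : ℝ) / d := fun d =>
      (card_multiples_le _).trans (by gcongr)
    have e1 : (N : ℝ) / ((i.1 * i.2 : ℕ) : ℝ) / i.1 = N * (1 / (i.1 : ℝ) ^ 2 * (1 / i.2)) := by
      push_cast; rw [div_div, one_div_mul_one_div, mul_one_div]; congr 1; ring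
    have e2 : (N : ℝ) / ((i.1 * i.2 : ℕ) : ℝ) / i.2 = N * (1 / (i.1 : ℝ) * (1 / (i.2 : ℝ) ^ 2)) := by
      push_cast; rw [div_div, one_div_mul_one_div, mul_one_div]; congr 1; ring
    have h1 := hb i.1
    have h2 := hb i.2
    rw [e1] at h1
    rw [e2] at h2
    linarith
  refine (norm_sum_le _ _).trans ((sum_le_sum hterm).trans ?_)
  have hsub : S.offDiag ⊆ S ×ˢ S := fun i hi => by
    rw [mem_offDiag] at hi
    exact mem_product.2 ⟨hi.1, hi.2.1⟩
  refine (sum_le_sum_of_subset_of_nonneg hsub fun _ _ _ => by positivity).trans ?_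
  rw [← mul_sum, sum_add_distrib,
    sum_product' (f := fun p q : ℕ => 1 / (p : ℝ) ^ 2 * (1 / (q : ℝ))),
    sum_product' (f := fun p q : ℕ => 1 / (p : ℝ) * (1 / (q : ℝ) ^ 2)), ← sum_mul_sum,
    ← sum_mul_sum]
  have h1 := sum_inv_sq_prime_le hS
  have h2 : 0 ≤ ∑ p ∈ S, (1 : ℝ) / p := by positivity
  have h3 : (∑ p ∈ S, 1 / (p : ℝ) ^ 2) * ∑ p ∈ S, (1 : ℝ) / p ≤ ∑ p ∈ S, (1 : ℝ) / p :=
    mul_le_of_le_one_left h2 h1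
  have hN : (0 : ℝ) ≤ 4 * N := by positivity
  calc _ ≤ 4 * (N : ℝ) * (∑ p ∈ S, (1 : ℝ) / p + ∑ p ∈ S, (1 : ℝ) / p) :=
        mul_le_mul_of_nonneg_left (by linarith) hN
    _ = _ := by ring

open Finset in
/-- A variant of the **Daboussi–Kátai criterion** in which the summand may depend on the number of
divisors of the argument. -/
theorem norm_sum_card_divisors_le_of_correlation {S : Finset ℕ} {z : ℕ} (hS : ∀ p ∈ S, p.Prime)
    (hz : ∀ p ∈ S, p ≤ z) (N : ℕ) (T : Finset ℕ) (h : ℕ → ℕ → ℂ) (hh : ∀ t n, ‖h t n‖ ≤ 2)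
    {L δ : ℝ} (hL : L = ∑ p ∈ S, (1 : ℝ) / p) (hL1 : 1 ≤ L) (hδ : 0 ≤ δ)
    (hzN : 12 * (z : ℝ) ^ 4 ≤ N * L) (hδN : (#S : ℝ) ^ 4 * δ ≤ N * L ^ 2)
    (hcorr : ∀ t ∈ T, ∀ i ∈ S.offDiag, ∀ j ∈ S.offDiag, i.1 * i.2 ≠ j.1 * j.2 →
      ‖∑ m ∈ Icc 1 (min (N / (i.1 * i.2)) (N / (j.1 * j.2))),
        h t (i.1 * i.2 * m) * (starRingEnd ℂ) (h t (j.1 * j.2 * m))‖ ≤ δ) :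
    ‖∑ n ∈ Icc 1 N, if n.divisors.card ∈ T then h n.divisors.card n else 0‖ ≤
      N * (20 / Real.sqrt L + 3 * Real.sqrt #T / L) := by
  set g : ℕ → ℕ → ℂ := fun t n => if t ∈ T then h t n else 0 with hg
  have hgb : ∀ t n, ‖g t n‖ ≤ 2 := fun t n => by
    simp only [hg]
    split_ifs
    · exact hh t n
    · simp
  set f : ℕ → ℂ := fun n => g n.divisors.card n with hf
  set w : ℕ → ℝ := fun n => (#{p ∈ S | p ∣ n} : ℝ) with hw
  change ‖∑ n ∈ Icc 1 N, f n‖ ≤ _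
  have hL0 : 0 < L := by linarith
  have hTK := sum_sq_card_dvd_sub_le hS hz 0 N
  simp only [add_zero, ← hL] at hTK
  have hV : ∑ n ∈ Icc 1 N, (w n - L) ^ 2 ≤ 2 * N * L := by linarith
  have habs := sum_abs_card_mul_sub_sq_le N hL hV
  have h1 : ‖((L ^ 2 : ℝ) : ℂ) * ∑ n ∈ Icc 1 N, f n -
      ∑ n ∈ Icc 1 N, (#{i ∈ S.offDiag | i.1 * i.2 ∣ n} : ℂ) * f n‖ ≤
      2 * (2 * N * L + 2 * L * Real.sqrt (N * (2 * N * L)) + N * L) := by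
    rw [mul_sum, ← sum_sub_distrib]
    refine (norm_sum_le _ _).trans (le_trans ?_ (mul_le_mul_of_nonneg_left habs zero_le_two))
    rw [mul_sum]
    refine sum_le_sum fun n _ => ?_
    have e : (#{i ∈ S.offDiag | i.1 * i.2 ∣ n} : ℂ) = ((w n * (w n - 1) : ℝ) : ℂ) := by
      rw [← sum_offDiag_dvd_eq hS n]
      push_cast
      rfl
    rw [e, ← sub_mul, norm_mul, ← Complex.ofReal_sub, Complex.norm_real, Real.norm_eq_abs,
      abs_sub_comm, mul_comm]
    exact mul_le_mul_of_nonneg_right (hgb _ _) (abs_nonneg _)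
  rw [sum_mul_card_offDiag_eq hS N f] at h1
  have h2 := sum_offDiag_norm_sub_le hS N g hgb
  rw [← hL] at h2
  have h3 : ‖∑ i ∈ S.offDiag, ∑ m ∈ Icc 1 (N / (i.1 * i.2)),
      g (4 * m.divisors.card) (i.1 * i.2 * m)‖ ≤ 3 * N * L * Real.sqrt #T := by
    set W : ℕ → ℕ → ℂ := fun t m =>
      ∑ i ∈ S.offDiag, if m ≤ N / (i.1 * i.2) then h t (i.1 * i.2 * m) else 0 with hW
    have hswap : ∑ i ∈ S.offDiag, ∑ m ∈ Icc 1 (N / (i.1 * i.2)),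
        g (4 * m.divisors.card) (i.1 * i.2 * m) =
        ∑ m ∈ Icc 1 N, if 4 * m.divisors.card ∈ T then W (4 * m.divisors.card) m else 0 := by
      have hin : ∀ i ∈ S.offDiag, ∑ m ∈ Icc 1 (N / (i.1 * i.2)),
          g (4 * m.divisors.card) (i.1 * i.2 * m) = ∑ m ∈ Icc 1 N,
          if m ≤ N / (i.1 * i.2) then g (4 * m.divisors.card) (i.1 * i.2 * m) else 0 := by
        intro i _
        refine (sum_congr ?_ fun _ _ => rfl).trans (sum_filter (fun m => m ≤ N / (i.1 * i.2)) _)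
        ext m
        simp only [mem_Icc, mem_filter]
        have := Nat.div_le_self N (i.1 * i.2)
        omega
      rw [sum_congr rfl hin, sum_comm]
      refine sum_congr rfl fun m _ => ?_
      simp only [hg, hW]
      split_ifs <;> simp
    rw [hswap]
    refine (norm_sum_le _ _).trans ?_
    have hcs := sq_sum_le_card_mul_sum_sq (s := Icc 1 N) (f := fun m =>
      ‖if 4 * m.divisors.card ∈ T then W (4 * m.divisors.card) m else 0‖)
    rw [Nat.card_Icc, Nat.add_sub_cancel] at hcs
    have hle : ∑ m ∈ Icc 1 N,
        ‖if 4 * m.divisors.card ∈ T then W (4 * m.divisors.card) m else 0‖ ^ 2 ≤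
        ∑ t ∈ T, ∑ m ∈ Icc 1 N, ‖W t m‖ ^ 2 := by
      rw [sum_comm]
      refine sum_le_sum fun m _ => ?_
      split_ifs with hm
      · exact single_le_sum (f := fun t => ‖W t m‖ ^ 2) (fun _ _ => by positivity) hm
      · rw [norm_zero, zero_pow two_ne_zero]
        positivity
    have hT : ∑ t ∈ T, ∑ m ∈ Icc 1 N, ‖W t m‖ ^ 2 ≤ #T * (9 * N * L ^ 2) := by
      rw [← nsmul_eq_mul]
      refine sum_le_card_nsmul _ _ _ fun t ht => ?_
      have := sum_sq_norm_sum_le_of_correlation hS N (h t) (hh t) hδ (hcorr t ht)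
      rw [← hL] at this
      linarith
    refine abs_le_of_sq_le_sq' ?_ (by positivity) |>.2
    refine hcs.trans ?_
    have e : (3 * N * L * Real.sqrt #T) ^ 2 = N * (#T * (9 * N * L ^ 2)) := by
      rw [mul_pow, Real.sq_sqrt (by positivity)]; ring
    rw [e]
    exact mul_le_mul_of_nonneg_left (hle.trans hT) (by positivity)
  have htot : L ^ 2 * ‖∑ n ∈ Icc 1 N, f n‖ ≤
      2 * (2 * N * L + 2 * L * Real.sqrt (N * (2 * N * L)) + N * L) + 8 * N * L +
        3 * N * L * Real.sqrt #T := by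
    have e : L ^ 2 * ‖∑ n ∈ Icc 1 N, f n‖ = ‖((L ^ 2 : ℝ) : ℂ) * ∑ n ∈ Icc 1 N, f n‖ := by
      rw [norm_mul, Complex.norm_real, Real.norm_of_nonneg (by positivity)]
    rw [e]
    have := norm_le_norm_add_norm_sub'
      (((L ^ 2 : ℝ) : ℂ) * ∑ n ∈ Icc 1 N, f n)
      (∑ i ∈ S.offDiag, ∑ m ∈ Icc 1 (N / (i.1 * i.2)), f (i.1 * i.2 * m))
    have := norm_le_norm_add_norm_sub'
      (∑ i ∈ S.offDiag, ∑ m ∈ Icc 1 (N / (i.1 * i.2)), f (i.1 * i.2 * m))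
      (∑ i ∈ S.offDiag, ∑ m ∈ Icc 1 (N / (i.1 * i.2)), g (4 * m.divisors.card) (i.1 * i.2 * m))
    linarith
  have hsq : Real.sqrt (N * (2 * N * L)) ≤ 3 / 2 * N * Real.sqrt L := by
    rw [Real.sqrt_le_left (by positivity), mul_pow, Real.sq_sqrt hL0.le]
    have : 0 ≤ (N : ℝ) ^ 2 * L := by positivity
    nlinarith
  have hs1 : 1 ≤ Real.sqrt L := Real.one_le_sqrt.2 hL1
  have hss : Real.sqrt L * Real.sqrt L = L := Real.mul_self_sqrt hL0.le
  have hrhs : L ^ 2 * (N * (20 / Real.sqrt L + 3 * Real.sqrt #T / L)) =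
      20 * N * L * Real.sqrt L + 3 * N * L * Real.sqrt #T := by
    have : Real.sqrt L ≠ 0 := by positivity
    field_simp
    linear_combination (-20 * N : ℝ) * hss
  refine le_of_mul_le_mul_left ?_ (by positivity : 0 < L ^ 2)
  rw [hrhs]
  have hNL : 0 ≤ (N : ℝ) * L := by positivity
  have h4 := mul_le_mul_of_nonneg_left hsq (by positivity : 0 ≤ 4 * L)
  nlinarith [mul_le_mul_of_nonneg_left hs1 hNL]

open Finset in
/-- The primes `p` with `exp (exp a) < p ≤ exp (exp b)`. -/
noncomputable def primesBetween (a b : ℝ) : Finset ℕ :=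
  {p ∈ Nat.primesLE ⌊Real.exp (Real.exp b)⌋₊ | Real.exp (Real.exp a) < p}

theorem mem_primesBetween {a b : ℝ} {p : ℕ} : p ∈ primesBetween a b ↔
    p.Prime ∧ Real.exp (Real.exp a) < p ∧ (p : ℝ) ≤ Real.exp (Real.exp b) := by
  rw [primesBetween, Finset.mem_filter, Nat.mem_primesLE,
    Nat.le_floor_iff (Real.exp_pos _).le]
  tauto

open Finset in
theorem exists_abs_sum_primesBetween_sub_le : ∃ C : ℝ, ∀ a b : ℝ, 0 ≤ a → a ≤ b →
    |∑ p ∈ primesBetween a b, (1 : ℝ) / p - (b - a)| ≤ C := by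
  obtain ⟨C, hC⟩ := exists_abs_sum_inv_prime_sub_log_log_le
  refine ⟨2 * C, fun a b ha hab => ?_⟩
  have htwo : ∀ c : ℝ, 0 ≤ c → 2 ≤ Real.exp (Real.exp c) := fun c hc => by
    have h1 := Real.add_one_le_exp (Real.exp c)
    have h2 := Real.add_one_le_exp c
    linarith
  have hA := hC _ (htwo a ha)
  have hB := hC _ (htwo b (ha.trans hab))
  simp only [Real.log_exp] at hA hB
  have hsub : Nat.primesLE ⌊Real.exp (Real.exp a)⌋₊ ⊆ Nat.primesLE ⌊Real.exp (Real.exp b)⌋₊ := by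
    intro p
    rw [Nat.mem_primesLE, Nat.mem_primesLE]
    refine And.imp_left fun h => h.trans (Nat.floor_le_floor ?_)
    gcongr
  have heq : primesBetween a b =
      Nat.primesLE ⌊Real.exp (Real.exp b)⌋₊ \ Nat.primesLE ⌊Real.exp (Real.exp a)⌋₊ := by
    ext p
    rw [mem_primesBetween, Finset.mem_sdiff, Nat.mem_primesLE, Nat.mem_primesLE,
      Nat.le_floor_iff (Real.exp_pos _).le, Nat.le_floor_iff (Real.exp_pos _).le, ← not_le]
    tauto
  have hs := sum_sdiff hsub (f := fun p : ℕ => (1 : ℝ) / p)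
  rw [heq]
  rw [abs_le] at hA hB ⊢
  constructor <;> linarith

open Finset in
theorem sum_inv_sq_primesBetween_le (a b : ℝ) :
    ∑ p ∈ primesBetween a b, (1 : ℝ) / (p : ℝ) ^ 2 ≤ 2 / Real.exp (Real.exp a) := by
  set Y := Real.exp (Real.exp a)
  have hY : 0 < Y := Real.exp_pos _
  have hsub : primesBetween a b ⊆ Ioo ⌊Y⌋₊ (⌊Real.exp (Real.exp b)⌋₊ + 1) := fun p hp => by
    rw [mem_primesBetween] at hp
    rw [mem_Ioo, Nat.floor_lt hY.le, Nat.lt_succ_iff, Nat.le_floor_iff (Real.exp_pos _).le]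
    exact hp.2
  have h := sum_Ioo_inv_sq_le (α := ℝ) ⌊Y⌋₊ (⌊Real.exp (Real.exp b)⌋₊ + 1)
  simp only [one_div]
  refine (sum_le_sum_of_subset_of_nonneg hsub fun _ _ _ => by positivity).trans (h.trans ?_)
  have := (Nat.lt_floor_add_one Y).le
  gcongr

theorem not_prime_dvd_of_lt {r a : ℕ} (h : a < r) (h0 : 0 < a) : ¬ r ∣ a :=
  Nat.not_dvd_of_pos_of_lt h0 h

open Finset in
theorem norm_sum_centred_primeTwist_card_divisors_le {R S T : Finset ℕ} {z q Y : ℕ}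
    (hR : ∀ r ∈ R, r.Prime) (hRz : ∀ r ∈ R, r ≤ z) (hRY : ∀ r ∈ R, Y < r) (hz1 : 1 ≤ z)
    (hS : ∀ p ∈ S, p.Prime) (hSq : ∀ p ∈ S, p ≤ q) (hqY : q ^ 2 ≤ Y) (hT0 : ∀ t ∈ T, 0 < t)
    (hTY : ∀ t ∈ T, t ≤ Y) {ζ : ℂ} (hζ : ‖ζ‖ = 1) (N K : ℕ) {L : ℝ}
    (hL : L = ∑ p ∈ S, (1 : ℝ) / p) (hL1 : 1 ≤ L) (hqN : 12 * (q : ℝ) ^ 4 ≤ N * L)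
    (hδ : (q : ℝ) ^ 4 * (3 * sieveError R z K N + 4 * N * ∑ r ∈ R, (1 : ℝ) / (r : ℝ) ^ 2) ≤
      N * L ^ 2) :
    ‖∑ n ∈ Icc 1 N, if n.divisors.card ∈ T then
      primeTwist R ζ (n + n.divisors.card) - primeTwistMean R ζ else 0‖ ≤
      N * (20 / Real.sqrt L + 3 * Real.sqrt #T / L) := by
  have hs0 : 0 ≤ 3 * sieveError R z K N + 4 * N * ∑ r ∈ R, (1 : ℝ) / (r : ℝ) ^ 2 := by
    rw [sieveError]; positivity
  have hSc : (#S : ℝ) ≤ q := by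
    have h1 : S ⊆ Icc 1 q := fun p hp => mem_Icc.2 ⟨(hS p hp).one_le, hSq p hp⟩
    have := card_le_card h1
    rw [Nat.card_Icc] at this
    exact_mod_cast this
  refine norm_sum_card_divisors_le_of_correlation hS hSq N T
    (fun t n => primeTwist R ζ (n + t) - primeTwistMean R ζ) (fun t n => ?_) hL hL1 hs0 hqN
    (le_trans (by gcongr) hδ) ?_
  · refine (norm_sub_le _ _).trans ?_
    linarith [norm_primeTwist_le R hζ (n + t), norm_primeTwistMean_le hR hζ]
  · intro t ht i hi j hj hij
    rw [mem_offDiag] at hi hj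
    have hbd : ∀ k : ℕ × ℕ, k.1 ∈ S → k.2 ∈ S → 0 < k.1 * k.2 ∧ k.1 * k.2 ≤ Y := fun k h1 h2 =>
      ⟨Nat.mul_pos (hS _ h1).pos (hS _ h2).pos,
        le_trans (by rw [sq]; exact Nat.mul_le_mul (hSq _ h1) (hSq _ h2)) hqY⟩
    obtain ⟨hi0, hiY⟩ := hbd i hi.1 hi.2.1
    obtain ⟨hj0, hjY⟩ := hbd j hj.1 hj.2.1
    have hab : ∀ r ∈ R, ¬ (r : ℤ) ∣ ((i.1 * i.2 : ℕ) : ℤ) - (j.1 * j.2 : ℕ) := by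
      intro r hr hd
      have h1 := Int.le_of_dvd (by
        rw [abs_pos, sub_ne_zero]; exact_mod_cast hij) ((dvd_abs _ _).2 hd)
      have h2 := hRY r hr
      rw [le_abs] at h1
      omega
    have h := norm_sum_centred_primeTwist_mul_conj_le hR hRz hz1 hζ
      (fun r hr => not_prime_dvd_of_lt (hiY.trans_lt (hRY r hr)) hi0)
      (fun r hr => not_prime_dvd_of_lt (hjY.trans_lt (hRY r hr)) hj0)
      (fun r hr => not_prime_dvd_of_lt ((hTY t ht).trans_lt (hRY r hr)) (hT0 t ht)) hab K
      (min (N / (i.1 * i.2)) (N / (j.1 * j.2)))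
    rw [sum_Icc_one_eq_sum_range]
    refine h.trans ?_
    have hMN : ((min (N / (i.1 * i.2)) (N / (j.1 * j.2)) : ℕ) : ℝ) ≤ N := by
      exact_mod_cast (min_le_left _ _).trans (Nat.div_le_self _ _)
    rw [sieveError, sieveError]
    gcongr

theorem pow_div_factorial_le_exp_neg {v Λ : ℝ} {K : ℕ} (hv : 30 ≤ v) (hΛ0 : 0 ≤ Λ) (hΛ : Λ ≤ v)
    (hK : v ^ 2 ≤ K) : (4 * Λ) ^ K / K.factorial ≤ Real.exp (-v ^ 2) := by
  have h1 := Real.pow_div_factorial_le_exp (4 * Λ * Real.exp 2) (by positivity) K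
  have he : Real.exp 2 ≤ 7.5 := by
    have : Real.exp 2 = Real.exp 1 * Real.exp 1 := by rw [← Real.exp_add]; norm_num
    rw [this]
    nlinarith [Real.exp_one_lt_d9, Real.exp_pos 1]
  rw [mul_pow, ← Real.exp_nat_mul, mul_div_right_comm] at h1
  have h2 : (4 * Λ) ^ K / K.factorial ≤ Real.exp (4 * Λ * Real.exp 2 - K * 2) := by
    rwa [Real.exp_sub, le_div_iff₀ (Real.exp_pos _)]
  refine h2.trans (Real.exp_le_exp.2 ?_)
  nlinarith [mul_le_mul hΛ he (Real.exp_pos _).le (by linarith)]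

theorem exp_sieve_bounds {v P q Λ σ N : ℝ} {K : ℕ} {z : ℝ} (hv : 30 ≤ v) (hΛ0 : 0 ≤ Λ) (hΛ : Λ ≤ v)
    (hP : v ^ 3 ≤ P) (hq0 : 0 ≤ q) (hq : q ≤ Real.exp v) (hK : v ^ 2 ≤ K) (hK' : (K : ℝ) ≤ v ^ 2 + 1)
    (hz0 : 0 ≤ z) (hz : z ≤ Real.exp (P / v ^ 4)) (hσ : σ ≤ 2 / Real.exp (v ^ 2))
    (hN : Real.exp P / 2 ≤ N) :
    12 * q ^ 4 ≤ N ∧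
    q ^ 4 * (3 * (2 * N * ((4 * Λ) ^ K / K.factorial) + 2 * (K + 1) * (2 * z ^ 2) ^ K) +
      4 * N * σ) ≤ N := by
  have hv2 : 900 ≤ v ^ 2 := by nlinarith
  have hv0 : 0 < v := by linarith
  have hP2 : 30 * v ^ 2 ≤ P := by nlinarith
  have hN0 : 0 ≤ N := le_trans (by positivity) hN
  have hq4 : q ^ 4 ≤ Real.exp (4 * v) := by
    rw [show (4 : ℝ) * v = (4 : ℕ) * v by norm_num, Real.exp_nat_mul]
    gcongr
  have hbig : ∀ y : ℝ, 100 ≤ y → (100 : ℝ) ≤ Real.exp y := fun y hy => by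
    linarith [Real.add_one_le_exp y]
  have hA : q ^ 4 * Real.exp (-v ^ 2) ≤ 1 / 100 := by
    calc q ^ 4 * Real.exp (-v ^ 2) ≤ Real.exp (4 * v) * Real.exp (-v ^ 2) := by gcongr
      _ = (Real.exp (v ^ 2 - 4 * v))⁻¹ := by rw [← Real.exp_add, ← Real.exp_neg]; ring_nf
      _ ≤ 1 / 100 := by
        rw [one_div]
        exact inv_anti₀ (by norm_num) (hbig _ (by nlinarith))
  have hB : q ^ 4 * (6 * (K + 1) * (2 * z ^ 2) ^ K) ≤ N / 3 := by
    have h1 : (K : ℝ) + 1 ≤ Real.exp K := Real.add_one_le_exp _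
    have h2 : 2 * z ^ 2 ≤ Real.exp (1 + 2 * (P / v ^ 4)) := by
      rw [Real.exp_add, show (2 : ℝ) * (P / v ^ 4) = (2 : ℕ) * (P / v ^ 4) by norm_num,
        Real.exp_nat_mul]
      have : (2 : ℝ) ≤ Real.exp 1 := by linarith [Real.add_one_le_exp (1 : ℝ)]
      gcongr
    have h3 : (2 * z ^ 2) ^ K ≤ Real.exp (K * (1 + 2 * (P / v ^ 4))) := by
      rw [Real.exp_nat_mul]
      gcongr
    have h4 : (K : ℝ) * (1 + 2 * (P / v ^ 4)) ≤ 2 * v ^ 2 + P / 4 := by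
      have h5 : (K : ℝ) ≤ 2 * v ^ 2 := by linarith
      have hP0 : 0 ≤ P := by nlinarith
      calc (K : ℝ) * (1 + 2 * (P / v ^ 4)) ≤ 2 * v ^ 2 * (1 + 2 * (P / v ^ 4)) := by gcongr
        _ = 2 * v ^ 2 + 4 * P / v ^ 2 := by field_simp; ring
        _ ≤ _ := by
          refine add_le_add_right ?_ _
          rw [div_le_div_iff₀ (by positivity) (by norm_num)]
          nlinarith
    calc q ^ 4 * (6 * (K + 1) * (2 * z ^ 2) ^ K)
        ≤ Real.exp (4 * v) * (6 * Real.exp (2 * v ^ 2) * Real.exp (2 * v ^ 2 + P / 4)) := by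
          gcongr
          · exact h1.trans (Real.exp_le_exp.2 (by linarith))
          · exact h3.trans (Real.exp_le_exp.2 h4)
      _ = 6 * Real.exp (4 * v + 4 * v ^ 2 + P / 4) := by
          rw [show 4 * v + 4 * v ^ 2 + P / 4 = 4 * v + (2 * v ^ 2 + (2 * v ^ 2 + P / 4)) by ring,
            Real.exp_add (4 * v), Real.exp_add (2 * v ^ 2) (2 * v ^ 2 + P / 4)]
          ring
      _ ≤ 6 * (Real.exp P / 100) := by
          gcongr
          rw [le_div_iff₀ (by norm_num)]
          calc Real.exp (4 * v + 4 * v ^ 2 + P / 4) * 100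
              ≤ Real.exp (4 * v + 4 * v ^ 2 + P / 4) * Real.exp 100 := by
                gcongr; exact hbig _ le_rfl
            _ = Real.exp (4 * v + 4 * v ^ 2 + P / 4 + 100) := by rw [Real.exp_add _ 100]
            _ ≤ Real.exp P := Real.exp_le_exp.2 (by nlinarith)
      _ ≤ N / 3 := by linarith
  constructor
  · have : Real.exp (4 * v) * 100 ≤ Real.exp P := by
      calc Real.exp (4 * v) * 100 ≤ Real.exp (4 * v) * Real.exp 100 := by
            gcongr; exact hbig _ le_rfl
        _ = Real.exp (4 * v + 100) := by rw [Real.exp_add _ 100]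
        _ ≤ Real.exp P := Real.exp_le_exp.2 (by nlinarith)
    linarith
  · have hF := pow_div_factorial_le_exp_neg hv hΛ0 hΛ hK
    have h1 : q ^ 4 * ((4 * Λ) ^ K / K.factorial) ≤ 1 / 100 :=
      le_trans (by gcongr) hA
    have h2 : q ^ 4 * σ ≤ 2 / 100 := by
      calc q ^ 4 * σ ≤ q ^ 4 * (2 / Real.exp (v ^ 2)) := by gcongr
        _ = 2 * (q ^ 4 * Real.exp (-v ^ 2)) := by rw [Real.exp_neg]; ring
        _ ≤ _ := by linarith
    have e : q ^ 4 * (3 * (2 * N * ((4 * Λ) ^ K / K.factorial) + 2 * (K + 1) * (2 * z ^ 2) ^ K) +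
        4 * N * σ) = 6 * N * (q ^ 4 * ((4 * Λ) ^ K / K.factorial)) +
        q ^ 4 * (6 * (K + 1) * (2 * z ^ 2) ^ K) + 4 * N * (q ^ 4 * σ) := by ring
    rw [e]
    have h3 := mul_le_mul_of_nonneg_left h1 (by positivity : 0 ≤ 6 * N)
    have h4 := mul_le_mul_of_nonneg_left h2 (by positivity : 0 ≤ 4 * N)
    linarith

theorem half_exp_le_floor {y : ℝ} (hy : 1 ≤ y) : Real.exp y / 2 ≤ (⌊Real.exp y⌋₊ : ℝ) := by
  have h1 := Nat.lt_floor_add_one (Real.exp y)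
  have h2 := Real.add_one_le_exp y
  linarith

theorem eventually_pow_eight_le_exp_pow_three : ∀ᶠ w : ℝ in atTop, w ^ 8 ≤ Real.exp (w ^ 3) := by
  have h := (Real.isLittleO_pow_exp_atTop (n := 8)).bound (c := 1) one_pos
  filter_upwards [h, eventually_ge_atTop 1] with w hw h1
  rw [Real.norm_of_nonneg (by positivity), Real.norm_of_nonneg (by positivity), one_mul] at hw
  exact hw.trans (Real.exp_le_exp.2 (le_self_pow₀ h1 (by norm_num)))

open Finset in
theorem exists_eventually_norm_sum_primeTwist_card_divisors_le (D : ℝ) (T : ℝ → Finset ℕ)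
    (hTD : ∀ᶠ w in atTop, (#(T w) : ℝ) ≤ D * w ^ 4)
    (hT : ∀ᶠ w in atTop, ∀ t ∈ T w, 0 < t ∧ (t : ℝ) ≤ Real.exp (Real.exp (2 * w ^ 3)))
    (ζ : ℝ → ℂ) (hζ : ∀ w, ‖ζ w‖ = 1) :
    ∀ᶠ w in atTop, ‖∑ n ∈ Icc 1 ⌊Real.exp (Real.exp (w ^ 8))⌋₊, if n.divisors.card ∈ T w then
      primeTwist (primesBetween (2 * w ^ 3) (w ^ 8 - 4 * w ^ 3)) (ζ w) (n + n.divisors.card) -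
        primeTwistMean (primesBetween (2 * w ^ 3) (w ^ 8 - 4 * w ^ 3)) (ζ w) else 0‖ ≤
      ⌊Real.exp (Real.exp (w ^ 8))⌋₊ * ((20 + 6 * Real.sqrt D) / w) := by
  obtain ⟨C, hC⟩ := exists_abs_sum_primesBetween_sub_le
  filter_upwards [hTD, hT, eventually_pow_eight_le_exp_pow_three, eventually_ge_atTop 30,
    eventually_ge_atTop C] with w hD hTw h8 hw hwC
  have hw3 : 900 * w ≤ w ^ 3 := by nlinarith [mul_nonneg (by linarith : 0 ≤ w) (by nlinarith : (0 : ℝ) ≤ w ^ 2 - 900)]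
  have hw8 : 30 * w ^ 3 ≤ w ^ 8 := by
    have h1 : w ^ 4 ≤ w ^ 8 := pow_le_pow_right₀ (by linarith) (by norm_num)
    nlinarith [pow_nonneg (by linarith : 0 ≤ w) 3]
  set v := Real.exp (w ^ 3) with hv
  set P := Real.exp (w ^ 8) with hP
  have hv1 : w ^ 3 + 1 ≤ v := Real.add_one_le_exp _
  have hP1 : w ^ 8 + 1 ≤ P := Real.add_one_le_exp _
  have hv2 : Real.exp (2 * w ^ 3) = v ^ 2 := by
    rw [hv, ← Real.exp_nat_mul]; norm_num
  have hv3 : v ^ 3 ≤ P := by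
    rw [hv, ← Real.exp_nat_mul]
    refine Real.exp_le_exp.2 ?_
    push_cast
    linarith
  have hPv : Real.exp (w ^ 8 - 4 * w ^ 3) = P / v ^ 4 := by
    rw [Real.exp_sub, hv, ← Real.exp_nat_mul]; norm_num [hP]
  set R := primesBetween (2 * w ^ 3) (w ^ 8 - 4 * w ^ 3) with hR
  set S := primesBetween 0 (w ^ 3) with hS
  have hL := hC 0 (w ^ 3) le_rfl (by positivity)
  have hΛ := hC (2 * w ^ 3) (w ^ 8 - 4 * w ^ 3) (by positivity) (by nlinarith)
  rw [← hS, abs_le] at hL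
  rw [← hR, abs_le] at hΛ
  set L := ∑ p ∈ S, (1 : ℝ) / p with hLdef
  set Λ := ∑ p ∈ R, (1 : ℝ) / p with hΛdef
  have hLw : w ^ 3 / 2 ≤ L := by linarith
  have hL1 : 1 ≤ L := by linarith
  have hq : (⌊Real.exp v⌋₊ : ℝ) ≤ Real.exp v := Nat.floor_le (Real.exp_pos _).le
  obtain ⟨hb1, hb2⟩ := exp_sieve_bounds (v := v) (P := P) (q := ⌊Real.exp v⌋₊) (Λ := Λ)
    (σ := ∑ r ∈ R, (1 : ℝ) / (r : ℝ) ^ 2) (N := ⌊Real.exp P⌋₊) (K := ⌈v ^ 2⌉₊)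
    (z := ⌊Real.exp (P / v ^ 4)⌋₊) (by linarith) (by positivity) (by linarith) hv3 (by positivity) hq
    (Nat.le_ceil _) (Nat.ceil_lt_add_one (by positivity)).le (by positivity)
    (Nat.floor_le (Real.exp_pos _).le)
    (by rw [← hv2]; exact sum_inv_sq_primesBetween_le _ _) (half_exp_le_floor (by linarith))
  have hN0 : (0 : ℝ) ≤ (⌊Real.exp P⌋₊ : ℝ) := by positivity
  have hmain := norm_sum_centred_primeTwist_card_divisors_le (R := R) (S := S) (T := T w)
    (z := ⌊Real.exp (P / v ^ 4)⌋₊) (q := ⌊Real.exp v⌋₊) (Y := ⌊Real.exp (v ^ 2)⌋₊)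
    (fun r hr => (mem_primesBetween.1 hr).1)
    (fun r hr => Nat.le_floor (by rw [← hPv]; exact (mem_primesBetween.1 hr).2.2))
    (fun r hr => (Nat.floor_lt (Real.exp_pos _).le).2 (by
      rw [← hv2]; exact (mem_primesBetween.1 hr).2.1))
    (Nat.le_floor (by rw [Nat.cast_one]; exact Real.one_le_exp (by positivity)))
    (fun p hp => (mem_primesBetween.1 hp).1)
    (fun p hp => Nat.le_floor (mem_primesBetween.1 hp).2.2)
    (Nat.le_floor (by
      push_cast
      calc (⌊Real.exp v⌋₊ : ℝ) ^ 2 ≤ Real.exp v ^ 2 := by gcongr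
        _ = Real.exp (2 * v) := by rw [← Real.exp_nat_mul]; norm_num
        _ ≤ Real.exp (v ^ 2) := Real.exp_le_exp.2 (by nlinarith)))
    (fun t ht => (hTw t ht).1)
    (fun t ht => Nat.le_floor (by rw [← hv2]; exact (hTw t ht).2))
    (hζ w) ⌊Real.exp P⌋₊ ⌈v ^ 2⌉₊ hLdef hL1
    (hb1.trans (le_mul_of_one_le_right hN0 hL1))
    (by
      rw [sieveError]
      exact hb2.trans (le_mul_of_one_le_right hN0 (one_le_pow₀ hL1)))
  refine hmain.trans (mul_le_mul_of_nonneg_left ?_ hN0)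
  have hw0 : 0 < w := by linarith
  have hLw2 : w ^ 2 ≤ L := by nlinarith
  have e1 : w ≤ Real.sqrt L := Real.le_sqrt_of_sq_le hLw2
  have e2 : Real.sqrt #(T w) ≤ Real.sqrt D * w ^ 2 := by
    calc Real.sqrt #(T w) ≤ Real.sqrt (D * w ^ 4) := Real.sqrt_le_sqrt hD
      _ = Real.sqrt D * w ^ 2 := by
        rw [show w ^ 4 = (w ^ 2) ^ 2 by ring, Real.sqrt_mul' _ (by positivity),
          Real.sqrt_sq (by positivity)]
  calc 20 / Real.sqrt L + 3 * Real.sqrt #(T w) / L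
      ≤ 20 / w + 3 * (Real.sqrt D * w ^ 2) / (w ^ 3 / 2) := by gcongr
    _ = (20 + 6 * Real.sqrt D) / w := by field_simp; ring

open Finset in
theorem norm_primeTwistMean_sub_exp_le {R : Finset ℕ} (hR : ∀ r ∈ R, r.Prime) (φ : ℝ) :
    ‖primeTwistMean R (Complex.exp (φ * Complex.I)) -
      Complex.exp ((Complex.exp (φ * Complex.I) - 1) * (∑ r ∈ R, (1 : ℝ) / r : ℝ))‖ ≤
      4 * ∑ r ∈ R, (1 : ℝ) / (r : ℝ) ^ 2 := by
  have hζ : ‖Complex.exp (φ * Complex.I)‖ = 1 := Complex.norm_exp_ofReal_mul_I φ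
  have hu : ‖Complex.exp (φ * Complex.I) - 1‖ ≤ 2 := norm_sub_one_le_two hζ
  have hre : (Complex.exp (φ * Complex.I) - 1).re ≤ 0 := by
    rw [Complex.sub_re, Complex.exp_ofReal_mul_I_re, Complex.one_re]
    linarith [Real.cos_le_one φ]
  set u := Complex.exp (φ * Complex.I) - 1
  have hexp : Complex.exp (u * (∑ r ∈ R, (1 : ℝ) / r : ℝ)) =
      ∏ r ∈ R, Complex.exp (u / (r : ℂ)) := by
    rw [← Complex.exp_sum]
    push_cast
    rw [mul_sum]
    simp only [mul_one_div]
  rw [hexp, primeTwistMean]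
  refine (norm_prod_sub_prod_le_sum R _ _
    (fun r hr => norm_one_add_div_natCast_le hζ (hR r hr).one_le) (fun r hr => ?_)).trans ?_
  · rw [Complex.norm_exp, Complex.div_natCast_re]
    exact Real.exp_le_one_iff.2 (div_nonpos_of_nonpos_of_nonneg hre (by positivity))
  · rw [mul_sum]
    refine sum_le_sum fun r hr => ?_
    have hr2 : (2 : ℝ) ≤ r := by exact_mod_cast (hR r hr).two_le
    have hn : ‖u / (r : ℂ)‖ ≤ 2 / r := by
      rw [norm_div, Complex.norm_natCast]
      gcongr
    have h1 := Complex.norm_exp_sub_one_sub_id_le (hn.trans ((div_le_one (by linarith)).2 hr2))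
    have e : 1 + u / (r : ℂ) - Complex.exp (u / r) = -(Complex.exp (u / r) - 1 - u / r) := by ring
    rw [e, norm_neg]
    refine h1.trans ?_
    calc ‖u / (r : ℂ)‖ ^ 2 ≤ (2 / r) ^ 2 := by gcongr
      _ = 4 * (1 / (r : ℝ) ^ 2) := by rw [div_pow]; ring

theorem norm_exp_ofReal_mul_I_sub_le (φ : ℝ) :
    ‖Complex.exp (φ * Complex.I) - 1 - φ * Complex.I + (φ : ℂ) ^ 2 / 2‖ ≤
      |φ| ^ 3 * Real.exp |φ| := by
  have h := Complex.norm_exp_sub_sum_le_norm_mul_exp (φ * Complex.I) 3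
  rw [norm_mul, Complex.norm_I, mul_one, Complex.norm_real, Real.norm_eq_abs] at h
  refine le_of_eq_of_le ?_ h
  congr 1
  simp only [Finset.sum_range_succ, Finset.sum_range_zero, Nat.factorial]
  push_cast
  linear_combination (φ : ℂ) ^ 2 / 2 * Complex.I_sq

open Topology in
theorem tendsto_primeTwistMean_mul_exp (θ : ℝ) :
    Tendsto (fun w : ℝ => primeTwistMean (primesBetween (2 * w ^ 3) (w ^ 8 - 4 * w ^ 3))
      (Complex.exp ((θ / w ^ 4 : ℝ) * Complex.I)) * Complex.exp ((-(θ * w ^ 4) : ℝ) * Complex.I))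
      atTop (𝓝 (Complex.exp (-θ ^ 2 / 2))) := by
  obtain ⟨C, hC⟩ := exists_abs_sum_primesBetween_sub_le
  set R : ℝ → Finset ℕ := fun w => primesBetween (2 * w ^ 3) (w ^ 8 - 4 * w ^ 3) with hR
  set Λ : ℝ → ℝ := fun w => ∑ r ∈ R w, (1 : ℝ) / r with hΛ
  set u : ℝ → ℂ := fun w => Complex.exp ((θ / w ^ 4 : ℝ) * Complex.I) - 1 with hu
  have hΛw : ∀ᶠ w : ℝ in atTop, |Λ w - w ^ 8| ≤ 7 * w ^ 3 := by
    filter_upwards [eventually_ge_atTop 30, eventually_ge_atTop C] with w hw hwC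
    have hw3 : w ≤ w ^ 3 := le_self_pow₀ (by linarith) (by norm_num)
    have h5 : (30 : ℝ) ^ 5 ≤ w ^ 5 := by gcongr
    have hw8 : 6 * w ^ 3 ≤ w ^ 8 := by
      have : w ^ 8 = w ^ 5 * w ^ 3 := by ring
      rw [this]
      exact mul_le_mul_of_nonneg_right (by linarith) (by positivity)
    have h := hC (2 * w ^ 3) (w ^ 8 - 4 * w ^ 3) (by positivity) (by linarith)
    rw [abs_le] at h ⊢
    simp only [hΛ, hR]
    constructor <;> linarith
  have hinv : Tendsto (fun w : ℝ => 1 / w) atTop (𝓝 0) := by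
    simpa using tendsto_inv_atTop_zero (𝕜 := ℝ)
  have hdiff : Tendsto (fun w => (Λ w - w ^ 8) / w ^ 4) atTop (𝓝 0) := by
    refine squeeze_zero_norm' (a := fun w => 7 * (1 / w)) ?_ (by simpa using hinv.const_mul 7)
    filter_upwards [hΛw, eventually_gt_atTop 0] with w h h0
    rw [Real.norm_eq_abs, abs_div, abs_of_nonneg (by positivity : 0 ≤ w ^ 4)]
    calc |Λ w - w ^ 8| / w ^ 4 ≤ 7 * w ^ 3 / w ^ 4 := by gcongr
      _ = 7 * (1 / w) := by field_simp
  have hratio : Tendsto (fun w => Λ w / w ^ 8) atTop (𝓝 1) := by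
    have h4 : Tendsto (fun w : ℝ => (1 / w) ^ 4) atTop (𝓝 0) := by simpa using hinv.pow 4
    have h := (hdiff.mul h4).const_add 1
    rw [mul_zero, add_zero] at h
    refine h.congr' ?_
    filter_upwards [eventually_gt_atTop 0] with w h0
    field_simp
    ring
  have hmean : Tendsto (fun w => (primeTwistMean (R w) (Complex.exp ((θ / w ^ 4 : ℝ) * Complex.I)) -
      Complex.exp (u w * (Λ w : ℝ))) * Complex.exp ((-(θ * w ^ 4) : ℝ) * Complex.I)) atTop (𝓝 0) := by
    have hlim : Tendsto (fun w : ℝ => 4 * (2 * (1 / w))) atTop (𝓝 0) := by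
      simpa using (hinv.const_mul 2).const_mul 4
    refine squeeze_zero_norm' ?_ hlim
    filter_upwards [eventually_ge_atTop 1] with w hw
    rw [norm_mul, Complex.norm_exp_ofReal_mul_I, mul_one]
    refine (norm_primeTwistMean_sub_exp_le (fun r hr => (mem_primesBetween.1 hr).1) _).trans ?_
    refine mul_le_mul_of_nonneg_left ((sum_inv_sq_primesBetween_le _ _).trans ?_) (by norm_num)
    have hw3 : w ≤ w ^ 3 := le_self_pow₀ hw (by norm_num)
    have h1 := Real.add_one_le_exp (2 * w ^ 3)
    have h2 := Real.add_one_le_exp (Real.exp (2 * w ^ 3))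
    rw [← mul_one_div]
    have hww : w ≤ Real.exp (Real.exp (2 * w ^ 3)) := by linarith
    gcongr
  have hexpo : Tendsto (fun w => u w * (Λ w : ℝ) + (-(θ * w ^ 4) : ℝ) * Complex.I) atTop
      (𝓝 (-θ ^ 2 / 2)) := by
    have herr : Tendsto (fun w => (u w - (θ / w ^ 4 : ℝ) * Complex.I +
        ((θ / w ^ 4 : ℝ) : ℂ) ^ 2 / 2) * (Λ w : ℝ)) atTop (𝓝 0) := by
      have hlim : Tendsto (fun w : ℝ => |θ| ^ 3 * Real.exp |θ| * (Λ w / w ^ 8) * (1 / w) ^ 4) atTop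
          (𝓝 0) := by
        simpa using (hratio.const_mul (|θ| ^ 3 * Real.exp |θ|)).mul (hinv.pow 4)
      refine squeeze_zero_norm' ?_ hlim
      filter_upwards [eventually_ge_atTop 1] with w hw
      have hΛ0 : 0 ≤ Λ w := by simp only [hΛ]; positivity
      have hw4 : 1 ≤ w ^ 4 := one_le_pow₀ hw
      rw [norm_mul, Complex.norm_real, Real.norm_of_nonneg hΛ0]
      have h := norm_exp_ofReal_mul_I_sub_le (θ / w ^ 4)
      have habs : |θ / w ^ 4| = |θ| / w ^ 4 := by
        rw [abs_div, abs_of_nonneg (by positivity : 0 ≤ w ^ 4)]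
      have h' : |θ| / w ^ 4 ≤ |θ| := div_le_self (abs_nonneg _) hw4
      calc _ ≤ |θ / w ^ 4| ^ 3 * Real.exp |θ / w ^ 4| * Λ w := by gcongr
        _ ≤ (|θ| / w ^ 4) ^ 3 * Real.exp |θ| * Λ w := by rw [habs]; gcongr
        _ = _ := by field_simp
    have h1 : Tendsto (fun w => ((θ * ((Λ w - w ^ 8) / w ^ 4) : ℝ) : ℂ) * Complex.I) atTop
        (𝓝 (((θ * 0 : ℝ) : ℂ) * Complex.I)) :=
      ((Complex.continuous_ofReal.tendsto _).comp (hdiff.const_mul θ)).mul_const _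
    have h2 : Tendsto (fun w => ((-θ ^ 2 / 2 * (Λ w / w ^ 8) : ℝ) : ℂ)) atTop
        (𝓝 ((-θ ^ 2 / 2 * 1 : ℝ) : ℂ)) :=
      (Complex.continuous_ofReal.tendsto _).comp (hratio.const_mul _)
    have h3 := (herr.add h1).add h2
    have e : (0 : ℂ) + ((θ * 0 : ℝ) : ℂ) * Complex.I + ((-θ ^ 2 / 2 * 1 : ℝ) : ℂ) =
        -θ ^ 2 / 2 := by push_cast; ring
    rw [e] at h3
    refine h3.congr' ?_
    filter_upwards [eventually_gt_atTop 0] with w h0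
    have hwc : (w : ℂ) ≠ 0 := by exact_mod_cast h0.ne'
    push_cast
    field_simp
    ring
  have hfin := hmean.add ((Complex.continuous_exp.tendsto _).comp hexpo)
  rw [zero_add] at hfin
  refine hfin.congr fun w => ?_
  simp only [Function.comp_apply, Complex.exp_add]
  ring

open Finset in
theorem card_primeFactors_gt_le {y : ℝ} (hy : 1 < y) {m k : ℕ} (hm : m ≠ 0) (hmk : (m : ℝ) ≤ y ^ k) :
    #{p ∈ m.primeFactors | y < (p : ℕ)} ≤ k := by
  set s := {p ∈ m.primeFactors | y < ((p : ℕ) : ℝ)} with hs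
  have h1 : ∏ p ∈ s, p ≤ m := by
    refine Nat.le_of_dvd (Nat.pos_of_ne_zero hm) ((prod_dvd_prod_of_subset s m.primeFactors (fun p => p)
      (filter_subset _ _)).trans (Nat.prod_primeFactors_dvd m))
  have h2 : y ^ #s ≤ ((∏ p ∈ s, p : ℕ) : ℝ) := by
    push_cast
    rw [← prod_const]
    exact prod_le_prod (fun _ _ => by linarith) fun p hp => (mem_filter.1 hp).2.le
  have h3 : y ^ #s ≤ y ^ k := h2.trans ((by exact_mod_cast h1 : _ ≤ (m : ℝ)).trans hmk)
  exact (pow_le_pow_iff_right₀ hy).1 h3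

open Finset in
theorem card_primeFactors_le_card_dvd_add {y : ℝ} (hy : 1 < y) {m k : ℕ} (hm : m ≠ 0)
    (hmk : (m : ℝ) ≤ y ^ k) :
    #{p ∈ Nat.primesLE ⌊y⌋₊ | p ∣ m} ≤ #m.primeFactors ∧
      #m.primeFactors ≤ #{p ∈ Nat.primesLE ⌊y⌋₊ | p ∣ m} + k := by
  constructor
  · refine card_le_card fun p hp => ?_
    rw [mem_filter, Nat.mem_primesLE] at hp
    exact Nat.mem_primeFactors.2 ⟨hp.1.2, hp.2, hm⟩
  · refine le_trans ?_ (add_le_add_right (card_primeFactors_gt_le hy hm hmk) _)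
    refine le_trans (card_le_card fun p hp => ?_) (card_union_le _ _)
    have hp' := Nat.mem_primeFactors.1 hp
    rw [mem_union, mem_filter, mem_filter, Nat.mem_primesLE, Nat.le_floor_iff (by linarith)]
    rcases le_or_gt (p : ℝ) y with h | h
    · exact Or.inl ⟨⟨h, hp'.1⟩, hp'.2.1⟩
    · exact Or.inr ⟨hp, h⟩

open Finset in
theorem card_le_abs_mul_sq_le {ι : Type*} (s : Finset ι) (f : ι → ℝ) {c : ℝ} (hc : 0 ≤ c) :
    (#{i ∈ s | c ≤ |f i|} : ℝ) * c ^ 2 ≤ ∑ i ∈ s, f i ^ 2 := by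
  rw [← nsmul_eq_mul, ← sum_const]
  refine (sum_le_sum fun i hi => ?_).trans
    (sum_le_sum_of_subset_of_nonneg (filter_subset _ _) fun _ _ _ => sq_nonneg _)
  rw [← sq_abs (f i)]
  exact pow_le_pow_left₀ hc (mem_filter.1 hi).2 2

open Finset in
theorem card_le_abs_card_dvd_sub_le {S : Finset ℕ} {z : ℕ} (hS : ∀ p ∈ S, p.Prime)
    (hz : ∀ p ∈ S, p ≤ z) (t N : ℕ) {c : ℝ} (hc : 0 < c) (hzN : 12 * (z : ℝ) ^ 4 ≤ N) :
    (#{n ∈ Icc 1 N | c ≤ |(#{p ∈ S | p ∣ n + t} : ℝ) - ∑ p ∈ S, (1 : ℝ) / p|} : ℝ) ≤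
      N * (∑ p ∈ S, (1 : ℝ) / p + 1) / c ^ 2 := by
  rw [le_div_iff₀ (by positivity)]
  refine (card_le_abs_mul_sq_le (Icc 1 N) _ hc.le).trans ?_
  linarith [sum_sq_card_dvd_sub_le hS hz t N]

theorem exists_sq_dvd_decomposition {n k₀ : ℕ} (hn : n ≠ 0) (h : ∀ k, k ^ 2 ∣ n → k ≤ k₀) :
    ∃ c ∈ Finset.Icc 1 (k₀ ^ 3), ∃ j, n.divisors.card = c.divisors.card * 2 ^ j ∧
      j ≤ n.primeFactors.card ∧ n.primeFactors.card ≤ j + k₀ ^ 3 := by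
  obtain ⟨m, k, hkm, hm⟩ := Nat.sq_mul_squarefree n
  have hk0 : k ≠ 0 := by rintro rfl; simp at hkm; exact hn hkm.symm
  have hk : k ≤ k₀ := h k ⟨m, hkm.symm⟩
  obtain ⟨m', hm'⟩ := Nat.gcd_dvd_right k m
  set g := Nat.gcd k m with hg
  have hg0 : 0 < g := Nat.gcd_pos_of_pos_left _ (Nat.pos_of_ne_zero hk0)
  have hgk : g ≤ k := Nat.gcd_le_left _ (Nat.pos_of_ne_zero hk0)
  have hsq : Squarefree m' := hm.squarefree_of_dvd (Dvd.intro_left g hm'.symm)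
  have hgm : g.Coprime m' := Nat.coprime_of_squarefree_mul (hm' ▸ hm)
  have hcop : k.Coprime m' := by
    have hd : k.gcd m' ∣ g := Nat.dvd_gcd (Nat.gcd_dvd_left _ _)
      ((Nat.gcd_dvd_right _ _).trans (Dvd.intro_left g hm'.symm))
    exact Nat.eq_one_of_dvd_coprimes hgm hd (Nat.gcd_dvd_right _ _)
  have hc : (k ^ 2 * g).Coprime m' := Nat.Coprime.mul_left (hcop.pow_left 2) hgm
  have hcn : n = k ^ 2 * g * m' := by rw [← hkm, hm', mul_assoc]
  have hcB : k ^ 2 * g ≤ k₀ ^ 3 := by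
    calc k ^ 2 * g ≤ k₀ ^ 2 * k₀ := Nat.mul_le_mul (Nat.pow_le_pow_left hk 2) (hgk.trans hk)
      _ = k₀ ^ 3 := by ring
  have hω : n.primeFactors.card = (k ^ 2 * g).primeFactors.card + m'.primeFactors.card := by
    rw [hcn, hc.primeFactors_mul, Finset.card_union_of_disjoint hc.disjoint_primeFactors]
  have hωc : (k ^ 2 * g).primeFactors.card ≤ k ^ 2 * g := by
    have : (k ^ 2 * g).primeFactors ⊆ Finset.Icc 1 (k ^ 2 * g) := fun p hp =>
      Finset.mem_Icc.2 ⟨(Nat.prime_of_mem_primeFactors hp).one_le, Nat.le_of_mem_primeFactors hp⟩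
    simpa using Finset.card_le_card this
  refine ⟨k ^ 2 * g, Finset.mem_Icc.2 ⟨Nat.mul_pos (pow_pos (Nat.pos_of_ne_zero hk0) 2) hg0, hcB⟩, m'.primeFactors.card, ?_, by omega,
    by omega⟩
  rw [hcn, hc.card_divisors_mul]
  congr 1
  rw [Nat.card_divisors hsq.ne_zero, ← Finset.prod_const]
  refine Finset.prod_congr rfl fun p hp => ?_
  have h1 := (Nat.prime_of_mem_primeFactors hp).factorization_pos_of_dvd hsq.ne_zero
    (Nat.dvd_of_mem_primeFactors hp)
  have h2 := hsq.natFactorization_le_one p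
  omega

open Finset in
theorem card_exists_sq_dvd_le (k₀ N : ℕ) :
    (#{n ∈ Icc 1 N | ∃ k ∈ Ioo k₀ (N + 1), k ^ 2 ∣ n} : ℝ) ≤ N * (2 / (k₀ + 1)) := by
  have hsub : {n ∈ Icc 1 N | ∃ k ∈ Ioo k₀ (N + 1), k ^ 2 ∣ n} ⊆
      (Ioo k₀ (N + 1)).biUnion fun k => {n ∈ Icc 1 N | k ^ 2 ∣ n} := by
    intro n hn
    rw [mem_filter] at hn
    obtain ⟨hn1, k, hk, hkn⟩ := hn
    exact mem_biUnion.2 ⟨k, hk, mem_filter.2 ⟨hn1, hkn⟩⟩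
  calc (#{n ∈ Icc 1 N | ∃ k ∈ Ioo k₀ (N + 1), k ^ 2 ∣ n} : ℝ)
      ≤ ∑ k ∈ Ioo k₀ (N + 1), (#{n ∈ Icc 1 N | k ^ 2 ∣ n} : ℝ) := by
        exact_mod_cast (card_le_card hsub).trans card_biUnion_le
    _ ≤ ∑ k ∈ Ioo k₀ (N + 1), N * ((k : ℝ) ^ 2)⁻¹ := by
        refine sum_le_sum fun k _ => (card_multiples_le N).trans (le_of_eq ?_)
        push_cast
        rw [div_eq_mul_inv]
    _ ≤ N * (2 / (k₀ + 1)) := by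
        rw [← mul_sum]
        exact mul_le_mul_of_nonneg_left (sum_Ioo_inv_sq_le _ _) (by positivity)

open Finset in
/-- The values `τ(c) * 2 ^ j` with `1 ≤ c ≤ B` and `j` within about `A * w ^ 4` of `w ^ 8`. -/
noncomputable def typicalDivisorCounts (B : ℕ) (A w : ℝ) : Finset ℕ :=
  (Icc 1 B ×ˢ Icc (⌊w ^ 8 - A * w ^ 4⌋₊ - B) ⌊w ^ 8 + A * w ^ 4⌋₊).image
    fun i => i.1.divisors.card * 2 ^ i.2

open Finset in
theorem card_typicalDivisorCounts_le (B : ℕ) {A w : ℝ} (hA : 0 ≤ A) (hw : 1 ≤ w) :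
    (#(typicalDivisorCounts B A w) : ℝ) ≤ B * (2 * A + B + 2) * w ^ 4 := by
  have h1 : #(typicalDivisorCounts B A w) ≤
      B * (⌊w ^ 8 + A * w ^ 4⌋₊ + 1 - (⌊w ^ 8 - A * w ^ 4⌋₊ - B)) := by
    refine card_image_le.trans (le_of_eq ?_)
    rw [card_product, Nat.card_Icc, Nat.card_Icc, Nat.add_sub_cancel]
  have hw4 : 1 ≤ w ^ 4 := one_le_pow₀ hw
  have h2 : ⌊w ^ 8 - A * w ^ 4⌋₊ ≤ ⌊w ^ 8 + A * w ^ 4⌋₊ :=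
    Nat.floor_le_floor (by nlinarith [mul_nonneg hA (by linarith : 0 ≤ w ^ 4)])
  have h3 : ⌊w ^ 8 + A * w ^ 4⌋₊ + 1 - (⌊w ^ 8 - A * w ^ 4⌋₊ - B) + ⌊w ^ 8 - A * w ^ 4⌋₊ ≤
      ⌊w ^ 8 + A * w ^ 4⌋₊ + 1 + B := by omega
  have h4 : (⌊w ^ 8 + A * w ^ 4⌋₊ : ℝ) ≤ w ^ 8 + A * w ^ 4 := Nat.floor_le (by positivity)
  have h5 := Nat.lt_floor_add_one (w ^ 8 - A * w ^ 4)
  have h6 : ((⌊w ^ 8 + A * w ^ 4⌋₊ + 1 - (⌊w ^ 8 - A * w ^ 4⌋₊ - B) : ℕ) : ℝ) ≤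
      2 * A * w ^ 4 + 2 + B := by
    have : ((⌊w ^ 8 + A * w ^ 4⌋₊ + 1 - (⌊w ^ 8 - A * w ^ 4⌋₊ - B) : ℕ) : ℝ) +
      ⌊w ^ 8 - A * w ^ 4⌋₊ ≤ ⌊w ^ 8 + A * w ^ 4⌋₊ + 1 + B := by exact_mod_cast h3
    linarith
  calc (#(typicalDivisorCounts B A w) : ℝ)
      ≤ B * ((⌊w ^ 8 + A * w ^ 4⌋₊ + 1 - (⌊w ^ 8 - A * w ^ 4⌋₊ - B) : ℕ) : ℝ) := by
        exact_mod_cast h1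
    _ ≤ B * (2 * A * w ^ 4 + 2 + B) := by gcongr
    _ ≤ B * ((2 * A + B + 2) * w ^ 4) := by
        gcongr
        nlinarith [mul_nonneg (Nat.cast_nonneg (α := ℝ) B) (by linarith : 0 ≤ w ^ 4 - 1)]
    _ = _ := by ring

theorem eventually_typicalDivisorCounts_le (B : ℕ) {A : ℝ} (hA : 0 ≤ A) :
    ∀ᶠ w in atTop, ∀ t ∈ typicalDivisorCounts B A w,
      0 < t ∧ (t : ℝ) ≤ Real.exp (Real.exp (2 * w ^ 3)) := by
  filter_upwards [eventually_pow_eight_le_exp_pow_three, eventually_ge_atTop 1,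
    eventually_ge_atTop (B : ℝ), eventually_ge_atTop A, eventually_ge_atTop 3] with w h8 h1 hB hAw h3
  intro t ht
  obtain ⟨⟨c, j⟩, hcj, rfl⟩ := Finset.mem_image.1 ht
  obtain ⟨hc, hj⟩ := Finset.mem_product.1 hcj
  rw [Finset.mem_Icc] at hc hj
  simp only at hc hj ⊢
  refine ⟨Nat.mul_pos (Finset.card_pos.2 (Nat.nonempty_divisors.2 (by omega))) (by positivity), ?_⟩
  have hcB : ((c.divisors.card : ℕ) : ℝ) ≤ B := by
    exact_mod_cast (Nat.card_divisors_le_self c).trans hc.2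
  have hjw : (j : ℝ) ≤ w ^ 8 + A * w ^ 4 := (Nat.le_floor_iff (by positivity)).1 hj.2
  have he : (2 : ℝ) ≤ Real.exp 1 := by linarith [Real.add_one_le_exp (1 : ℝ)]
  have hw1 : w ≤ w ^ 8 := le_self_pow₀ h1 (by norm_num)
  have hw5 : w ^ 5 ≤ w ^ 8 := pow_le_pow_right₀ h1 (by norm_num)
  have hAw4 : A * w ^ 4 ≤ w ^ 8 := by
    calc A * w ^ 4 ≤ w * w ^ 4 := by gcongr
      _ = w ^ 5 := by ring
      _ ≤ w ^ 8 := hw5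
  have hv2 : Real.exp (2 * w ^ 3) = Real.exp (w ^ 3) ^ 2 := by
    rw [← Real.exp_nat_mul]; norm_num
  push_cast
  calc (c.divisors.card : ℝ) * 2 ^ j ≤ Real.exp (w ^ 8) * Real.exp 1 ^ j := by
        gcongr
        linarith [Real.add_one_le_exp (w ^ 8)]
    _ = Real.exp (w ^ 8 + j) := by rw [← Real.exp_nat_mul, Real.exp_add, mul_one]
    _ ≤ Real.exp (Real.exp (2 * w ^ 3)) := by
        refine Real.exp_le_exp.2 ?_
        rw [hv2]
        nlinarith

theorem card_divisors_mem_typicalDivisorCounts {k₀ n : ℕ} {A w : ℝ} (hn : n ≠ 0)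
    (h : ∀ k, k ^ 2 ∣ n → k ≤ k₀) (hω : |(n.primeFactors.card : ℝ) - w ^ 8| ≤ A * w ^ 4) :
    n.divisors.card ∈ typicalDivisorCounts (k₀ ^ 3) A w := by
  obtain ⟨c, hc, j, hτ, hj1, hj2⟩ := exists_sq_dvd_decomposition hn h
  rw [abs_le] at hω
  refine Finset.mem_image.2 ⟨(c, j), Finset.mem_product.2 ⟨hc, Finset.mem_Icc.2 ⟨?_, ?_⟩⟩, hτ.symm⟩
  · have : ⌊w ^ 8 - A * w ^ 4⌋₊ ≤ n.primeFactors.card := Nat.floor_le_of_le (by linarith)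
    simp only
    omega
  · refine Nat.le_floor ?_
    have : (j : ℝ) ≤ n.primeFactors.card := by exact_mod_cast hj1
    simp only
    linarith

open Finset in
theorem exists_eventually_abs_sum_inv_prime_sub_le :
    ∃ C : ℝ, ∀ᶠ w : ℝ in atTop,
      |∑ p ∈ Nat.primesLE ⌊Real.exp (Real.exp (w ^ 8) / 8)⌋₊, (1 : ℝ) / p - w ^ 8| ≤ C := by
  obtain ⟨C, hC⟩ := exists_abs_sum_inv_prime_sub_log_log_le
  refine ⟨C + Real.log 8, ?_⟩
  filter_upwards [eventually_ge_atTop 8] with w hw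
  have h1 : w ≤ w ^ 8 := le_self_pow₀ (by linarith) (by norm_num)
  have h2 := Real.add_one_le_exp (w ^ 8)
  have h3 := Real.add_one_le_exp (Real.exp (w ^ 8) / 8)
  have h := hC (Real.exp (Real.exp (w ^ 8) / 8)) (by linarith)
  rw [Real.log_exp, Real.log_div (Real.exp_pos _).ne' (by norm_num), Real.log_exp] at h
  have h8 : 0 ≤ Real.log 8 := Real.log_nonneg (by norm_num)
  rw [abs_le] at h ⊢
  constructor <;> linarith

theorem twelve_mul_floor_exp_pow_le {P : ℝ} (hP : 60 ≤ P) :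
    12 * (⌊Real.exp (P / 8)⌋₊ : ℝ) ^ 4 ≤ ⌊Real.exp P⌋₊ := by
  have h1 : (⌊Real.exp (P / 8)⌋₊ : ℝ) ^ 4 ≤ Real.exp (P / 2) := by
    rw [show P / 2 = (4 : ℕ) * (P / 8) by push_cast; ring, Real.exp_nat_mul]
    have := Nat.floor_le (Real.exp_pos (P / 8)).le
    gcongr
  have h2 : Real.exp P = Real.exp (P / 2) * Real.exp (P / 2) := by
    rw [← Real.exp_add]; congr 1; ring
  have h3 := Real.add_one_le_exp (P / 2)
  have h4 := half_exp_le_floor (y := P) (by linarith)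
  nlinarith [Real.exp_pos (P / 2)]

open Finset in
theorem eventually_card_abs_card_primeFactors_sub_le {A : ℝ} (hA : 0 < A) :
    ∀ᶠ w : ℝ in atTop, (#{n ∈ Icc 1 ⌊Real.exp (Real.exp (w ^ 8))⌋₊ |
      A * w ^ 4 < |(#n.primeFactors : ℝ) - w ^ 8|} : ℝ) ≤
      ⌊Real.exp (Real.exp (w ^ 8))⌋₊ * (8 / A ^ 2) := by
  obtain ⟨C, hC⟩ := exists_eventually_abs_sum_inv_prime_sub_le
  filter_upwards [hC, eventually_ge_atTop 60, eventually_ge_atTop (2 * (C + 8) / A),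
    eventually_ge_atTop (C + 1)] with w hCw hw hwA hwC
  have h8 : w ≤ w ^ 8 := le_self_pow₀ (by linarith) (by norm_num)
  have h4 : w ≤ w ^ 4 := le_self_pow₀ (by linarith) (by norm_num)
  have hw0 : 0 < w := by linarith
  set P := Real.exp (w ^ 8)
  have hP : w ^ 8 + 1 ≤ P := Real.add_one_le_exp _
  set S := Nat.primesLE ⌊Real.exp (P / 8)⌋₊
  set G := ∑ p ∈ S, (1 : ℝ) / p
  have hy : 1 < Real.exp (P / 8) := Real.one_lt_exp_iff.2 (by linarith)
  have hAw : 2 * (C + 8) ≤ A * w ^ 4 := by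
    rw [div_le_iff₀ hA] at hwA
    nlinarith
  have hsub : {n ∈ Icc 1 ⌊Real.exp P⌋₊ | A * w ^ 4 < |(#n.primeFactors : ℝ) - w ^ 8|} ⊆
      {n ∈ Icc 1 ⌊Real.exp P⌋₊ | A / 2 * w ^ 4 ≤ |(#{p ∈ S | p ∣ n + 0} : ℝ) - G|} := by
    intro n hn
    rw [mem_filter] at hn ⊢
    refine ⟨hn.1, ?_⟩
    obtain ⟨h1, h2⟩ := mem_Icc.1 hn.1
    rw [Nat.le_floor_iff (Real.exp_pos _).le] at h2
    obtain ⟨h5, h6⟩ := card_primeFactors_le_card_dvd_add hy (m := n) (k := 8) (by omega) (by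
      rw [← Real.exp_nat_mul]
      refine h2.trans (Real.exp_le_exp.2 (le_of_eq ?_))
      push_cast; ring)
    have h5' : (#{p ∈ S | p ∣ n} : ℝ) ≤ #n.primeFactors := by exact_mod_cast h5
    have h6' : (#n.primeFactors : ℝ) ≤ #{p ∈ S | p ∣ n} + 8 := by exact_mod_cast h6
    have h7 := hn.2
    rw [add_zero]
    rw [abs_le] at hCw
    rw [lt_abs] at h7
    rw [le_abs]
    rcases h7 with h7 | h7
    · left; linarith
    · right; linarith
  have hcount := card_le_abs_card_dvd_sub_le (S := S) (z := ⌊Real.exp (P / 8)⌋₊)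
    (fun p hp => Nat.prime_of_mem_primesLE hp) (fun p hp => (Nat.mem_primesLE.1 hp).1) 0
    ⌊Real.exp P⌋₊ (c := A / 2 * w ^ 4) (by positivity) (twelve_mul_floor_exp_pow_le (by linarith))
  refine (by exact_mod_cast card_le_card hsub : _ ≤ ((_ : ℕ) : ℝ)).trans (hcount.trans ?_)
  rw [mul_div_assoc]
  refine mul_le_mul_of_nonneg_left ?_ (by positivity)
  rw [abs_le] at hCw
  rw [div_le_div_iff₀ (by positivity) (by positivity)]
  have e : 8 * (A / 2 * w ^ 4) ^ 2 = 2 * w ^ 8 * A ^ 2 := by ring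
  rw [e]
  gcongr
  linarith

open Finset in
/-- Almost all integers have a typical number of divisors. -/
theorem exists_eventually_card_divisors_notMem_le {ε : ℝ} (hε : 0 < ε) :
    ∃ (B : ℕ) (A : ℝ), 0 ≤ A ∧ ∀ᶠ w : ℝ in atTop,
      (#{n ∈ Icc 1 ⌊Real.exp (Real.exp (w ^ 8))⌋₊ |
        n.divisors.card ∉ typicalDivisorCounts B A w} : ℝ) ≤
      ⌊Real.exp (Real.exp (w ^ 8))⌋₊ * ε := by
  obtain ⟨k₀, hk₀⟩ := exists_nat_gt (4 / ε)
  have hA : 0 < 4 / Real.sqrt ε := by positivity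
  refine ⟨k₀ ^ 3, 4 / Real.sqrt ε, hA.le, ?_⟩
  filter_upwards [eventually_card_abs_card_primeFactors_sub_le hA] with w hw
  set N := ⌊Real.exp (Real.exp (w ^ 8))⌋₊
  have hsub : {n ∈ Icc 1 N | n.divisors.card ∉ typicalDivisorCounts (k₀ ^ 3) (4 / Real.sqrt ε) w} ⊆
      {n ∈ Icc 1 N | ∃ k ∈ Ioo k₀ (N + 1), k ^ 2 ∣ n} ∪
      {n ∈ Icc 1 N | 4 / Real.sqrt ε * w ^ 4 < |(#n.primeFactors : ℝ) - w ^ 8|} := by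
    intro n hn
    rw [mem_filter] at hn
    rw [mem_union, mem_filter, mem_filter]
    by_contra hcon
    push Not at hcon
    have h1 := mem_Icc.1 hn.1
    refine hn.2 (card_divisors_mem_typicalDivisorCounts (by omega) (fun k hk => ?_)
      (hcon.2 hn.1))
    by_contra hk0
    have hle := Nat.le_of_dvd (by omega) hk
    exact hcon.1 hn.1 k (mem_Ioo.2 ⟨by omega, by nlinarith⟩) hk
  have h1 := card_exists_sq_dvd_le k₀ N
  have h2 : (2 : ℝ) / (k₀ + 1) ≤ ε / 2 := by
    rw [div_le_div_iff₀ (by positivity) (by norm_num)]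
    rw [div_lt_iff₀ hε] at hk₀
    linarith
  have h3 : 8 / (4 / Real.sqrt ε) ^ 2 = ε / 2 := by
    rw [div_pow, Real.sq_sqrt hε.le]
    field_simp
    norm_num
  rw [h3] at hw
  have h4 : (N : ℝ) * (2 / (k₀ + 1)) ≤ N * (ε / 2) := by gcongr
  have h5 : (#{n ∈ Icc 1 N | n.divisors.card ∉
      typicalDivisorCounts (k₀ ^ 3) (4 / Real.sqrt ε) w} : ℝ) ≤
      (#{n ∈ Icc 1 N | ∃ k ∈ Ioo k₀ (N + 1), k ^ 2 ∣ n} : ℝ) +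
      (#{n ∈ Icc 1 N | 4 / Real.sqrt ε * w ^ 4 < |(#n.primeFactors : ℝ) - w ^ 8|} : ℝ) := by
    exact_mod_cast (card_le_card hsub).trans (card_union_le _ _)
  linarith

open Finset in
theorem card_dvd_eq_card_sdiff_dvd_add {R S : Finset ℕ} (h : R ⊆ S) (m : ℕ) :
    #{p ∈ S | p ∣ m} = #{p ∈ S \ R | p ∣ m} + #{p ∈ R | p ∣ m} := by
  simp only [card_filter]
  exact (sum_sdiff h).symm

theorem primesBetween_subset_primesLE {w : ℝ} (hw : 2 ≤ w) :
    primesBetween (2 * w ^ 3) (w ^ 8 - 4 * w ^ 3) ⊆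
      Nat.primesLE ⌊Real.exp (Real.exp (w ^ 8) / 8)⌋₊ := by
  intro p hp
  rw [mem_primesBetween] at hp
  rw [Nat.mem_primesLE, Nat.le_floor_iff (Real.exp_pos _).le]
  refine ⟨hp.2.2.trans (Real.exp_le_exp.2 ?_), hp.1⟩
  rw [Real.exp_sub]
  have h1 := Real.add_one_le_exp (4 * w ^ 3)
  have h2 : (2 : ℝ) ^ 3 ≤ w ^ 3 := by gcongr
  gcongr
  linarith

open Finset in
theorem eventually_sum_sdiff_primesBetween_le : ∀ᶠ w : ℝ in atTop,
    ∑ p ∈ Nat.primesLE ⌊Real.exp (Real.exp (w ^ 8) / 8)⌋₊ \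
      primesBetween (2 * w ^ 3) (w ^ 8 - 4 * w ^ 3), (1 : ℝ) / p + 1 ≤ 8 * w ^ 3 := by
  obtain ⟨C₁, hC₁⟩ := exists_eventually_abs_sum_inv_prime_sub_le
  obtain ⟨C₂, hC₂⟩ := exists_abs_sum_primesBetween_sub_le
  filter_upwards [hC₁, eventually_ge_atTop 6, eventually_ge_atTop (C₁ + C₂ + 1)] with w h1 hw hwC
  have h3 : w ≤ w ^ 3 := le_self_pow₀ (by linarith) (by norm_num)
  have h4 : 6 * w ^ 3 ≤ w ^ 8 := by
    calc 6 * w ^ 3 ≤ w * w ^ 3 := by gcongr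
      _ = w ^ 4 := by ring
      _ ≤ w ^ 8 := pow_le_pow_right₀ (by linarith) (by norm_num)
  have h2 := hC₂ (2 * w ^ 3) (w ^ 8 - 4 * w ^ 3) (by positivity) (by linarith)
  have h5 := sum_sdiff (primesBetween_subset_primesLE (w := w) (by linarith))
    (f := fun p : ℕ => (1 : ℝ) / p)
  rw [abs_le] at h1 h2
  linarith

open Finset in
/-- For most `n`, nearly all the prime factors of `n + τ(n)` lie in the chosen window. -/
theorem eventually_card_lt_card_primeFactors_sub_le {D η : ℝ} (hη : 0 < η) {T : ℝ → Finset ℕ}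
    (hTD : ∀ᶠ w : ℝ in atTop, (#(T w) : ℝ) ≤ D * w ^ 4)
    (hT : ∀ᶠ w : ℝ in atTop, ∀ t ∈ T w, 0 < t ∧ (t : ℝ) ≤ Real.exp (Real.exp (2 * w ^ 3))) :
    ∀ᶠ w : ℝ in atTop, (#{n ∈ Icc 1 ⌊Real.exp (Real.exp (w ^ 8))⌋₊ | n.divisors.card ∈ T w ∧
      η * w ^ 4 < (#(n + n.divisors.card).primeFactors : ℝ) -
        #{r ∈ primesBetween (2 * w ^ 3) (w ^ 8 - 4 * w ^ 3) | r ∣ n + n.divisors.card}} : ℝ) ≤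
      ⌊Real.exp (Real.exp (w ^ 8))⌋₊ * (32 * D / (η ^ 2 * w)) := by
  filter_upwards [hTD, hT, eventually_sum_sdiff_primesBetween_le, eventually_ge_atTop 60,
    eventually_ge_atTop (34 / η)] with w hTD hT hG hw hwη
  have hw0 : 0 < w := by linarith
  have h8 : w ≤ w ^ 8 := le_self_pow₀ (by linarith) (by norm_num)
  have h3 : w ≤ w ^ 3 := le_self_pow₀ (by linarith) (by norm_num)
  set P := Real.exp (w ^ 8) with hPdef
  have hP : w ^ 8 + 1 ≤ P := Real.add_one_le_exp _
  set R := primesBetween (2 * w ^ 3) (w ^ 8 - 4 * w ^ 3)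
  set S := Nat.primesLE ⌊Real.exp (P / 8)⌋₊
  have hRS : R ⊆ S := primesBetween_subset_primesLE (by linarith)
  set G := ∑ p ∈ S \ R, (1 : ℝ) / p
  set N := ⌊Real.exp P⌋₊
  have hy : 1 < Real.exp (P / 8) := Real.one_lt_exp_iff.2 (by linarith)
  have hηw : 17 * w ^ 3 ≤ η / 2 * w ^ 4 := by
    rw [div_le_iff₀ hη] at hwη
    have : 34 * w ^ 3 ≤ (w * η) * w ^ 3 := by gcongr
    linarith
  have h23 : Real.exp (2 * w ^ 3) ≤ P := Real.exp_le_exp.2 <| by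
    calc 2 * w ^ 3 ≤ w * w ^ 3 := by gcongr; linarith
      _ = w ^ 4 := by ring
      _ ≤ w ^ 8 := pow_le_pow_right₀ (by linarith) (by norm_num)
  have hsub : {n ∈ Icc 1 N | n.divisors.card ∈ T w ∧
      η * w ^ 4 < (#(n + n.divisors.card).primeFactors : ℝ) -
        #{r ∈ R | r ∣ n + n.divisors.card}} ⊆
      (T w).biUnion fun t =>
        {n ∈ Icc 1 N | η / 2 * w ^ 4 ≤ |(#{p ∈ S \ R | p ∣ n + t} : ℝ) - G|} := by
    intro n hn
    rw [mem_filter] at hn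
    obtain ⟨hn1, hτ, hn2⟩ := hn
    refine mem_biUnion.2 ⟨n.divisors.card, hτ, mem_filter.2 ⟨hn1, ?_⟩⟩
    set t := n.divisors.card
    obtain ⟨h1, h2⟩ := mem_Icc.1 hn1
    rw [Nat.le_floor_iff (Real.exp_pos _).le] at h2
    have ht : (t : ℝ) ≤ Real.exp P := (hT t hτ).2.trans (Real.exp_le_exp.2 h23)
    have h6 := (card_primeFactors_le_card_dvd_add hy (m := n + t) (k := 9) (by omega) (by
      have e : Real.exp (P / 8) ^ 9 = Real.exp P * Real.exp (P / 8) := by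
        rw [← Real.exp_nat_mul, ← Real.exp_add]
        congr 1
        push_cast; ring
      rw [e]
      have := Real.add_one_le_exp (P / 8)
      push_cast
      nlinarith [Real.exp_pos P])).2
    rw [card_dvd_eq_card_sdiff_dvd_add hRS] at h6
    have h6' : (#(n + t).primeFactors : ℝ) ≤
        #{p ∈ S \ R | p ∣ n + t} + #{p ∈ R | p ∣ n + t} + 9 := by exact_mod_cast h6
    rw [le_abs]
    left
    linarith
  have hcount : ∀ t ∈ T w,
      (#{n ∈ Icc 1 N | η / 2 * w ^ 4 ≤ |(#{p ∈ S \ R | p ∣ n + t} : ℝ) - G|} : ℝ) ≤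
      N * (8 * w ^ 3) / (η / 2 * w ^ 4) ^ 2 := fun t _ => by
    refine (card_le_abs_card_dvd_sub_le (z := ⌊Real.exp (P / 8)⌋₊)
      (fun p hp => Nat.prime_of_mem_primesLE (mem_sdiff.1 hp).1)
      (fun p hp => (Nat.mem_primesLE.1 (mem_sdiff.1 hp).1).1) t N
      (by positivity) (twelve_mul_floor_exp_pow_le (by linarith))).trans ?_
    gcongr
  calc _ ≤ ∑ t ∈ T w,
        (#{n ∈ Icc 1 N | η / 2 * w ^ 4 ≤ |(#{p ∈ S \ R | p ∣ n + t} : ℝ) - G|} : ℝ) := by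
        exact_mod_cast (card_le_card hsub).trans card_biUnion_le
    _ ≤ #(T w) * (N * (8 * w ^ 3) / (η / 2 * w ^ 4) ^ 2) := by
        rw [← nsmul_eq_mul]
        exact sum_le_card_nsmul _ _ _ hcount
    _ ≤ (D * w ^ 4) * (N * (8 * w ^ 3) / (η / 2 * w ^ 4) ^ 2) := by gcongr
    _ = _ := by
        field_simp
        ring

open Finset in
theorem norm_sum_sub_const_le {ι : Type*} (s : Finset ι) (p q : ι → Prop) [DecidablePred p]
    [DecidablePred q] {F F' : ι → ℂ} {M : ℂ} {δ : ℝ} (hδ : 0 ≤ δ) (hF : ∀ i, ‖F i‖ ≤ 1)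
    (hF' : ∀ i, ‖F' i‖ ≤ 1) (hM : ‖M‖ ≤ 1)
    (hFF' : ∀ i ∈ s, p i → ¬ q i → ‖F i - F' i‖ ≤ δ) :
    ‖∑ i ∈ s, (F i - M)‖ ≤ #s * δ + 2 * #{i ∈ s | p i ∧ q i} + 2 * #{i ∈ s | ¬ p i} +
      ‖∑ i ∈ s, if p i then F' i - M else 0‖ := by
  have h1 : ∑ i ∈ s, (F i - M) = ∑ i ∈ s, (if p i then F i - F' i else F i - M) +
      ∑ i ∈ s, if p i then F' i - M else 0 := by
    rw [← sum_add_distrib]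
    refine sum_congr rfl fun i _ => ?_
    split_ifs <;> ring
  rw [h1]
  refine (norm_add_le _ _).trans (add_le_add_left ?_ _)
  have h2 : (#s * δ + 2 * #{i ∈ s | p i ∧ q i} + 2 * #{i ∈ s | ¬ p i} : ℝ) =
      ∑ i ∈ s, (δ + 2 * (if p i ∧ q i then 1 else 0) + 2 * (if ¬ p i then 1 else 0)) := by
    simp only [card_filter, sum_add_distrib, ← mul_sum, sum_const, nsmul_eq_mul]
    push_cast
    rfl
  rw [h2]
  refine (norm_sum_le _ _).trans (sum_le_sum fun i hi => ?_)
  have h3 := (norm_sub_le (F i) (F' i)).trans (add_le_add (hF i) (hF' i))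
  have h4 := (norm_sub_le (F i) M).trans (add_le_add (hF i) hM)
  by_cases hp : p i <;> by_cases hq : q i <;> simp only [hp, hq, if_true, if_false, and_true,
    and_false, and_self, not_true_eq_false, not_false_eq_true]
  · linarith
  · linarith [hFF' i hi hp hq]
  · linarith
  · linarith

theorem norm_exp_ofReal_mul_I_sub_exp_le (a b : ℝ) :
    ‖Complex.exp (a * Complex.I) - Complex.exp (b * Complex.I)‖ ≤ |a - b| := by
  have e : Complex.exp (a * Complex.I) - Complex.exp (b * Complex.I) =
      Complex.exp (b * Complex.I) * (Complex.exp (Complex.I * (a - b : ℝ)) - 1) := by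
    rw [mul_sub, ← Complex.exp_add, mul_one]
    congr 2
    push_cast
    ring
  rw [e, norm_mul, Complex.norm_exp_ofReal_mul_I, one_mul, ← Real.norm_eq_abs]
  exact Real.norm_exp_I_mul_ofReal_sub_one_le

open Finset in
theorem card_dvd_primesBetween_le (a b : ℝ) {m : ℕ} (hm : m ≠ 0) :
    #{r ∈ primesBetween a b | r ∣ m} ≤ #m.primeFactors := by
  refine card_le_card fun p hp => ?_
  rw [mem_filter, mem_primesBetween] at hp
  exact Nat.mem_primeFactors.2 ⟨hp.1.1, hp.2, hm⟩

theorem eventually_const_div_le (C : ℝ) {ε : ℝ} (hε : 0 < ε) : ∀ᶠ w : ℝ in atTop, C / w ≤ ε :=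
  ((tendsto_const_nhds.div_atTop tendsto_id).eventually_lt_const hε).mono fun _ h => h.le

open Finset in
theorem eventually_norm_average_exp_card_primeFactors_sub_le (θ : ℝ) {ε : ℝ} (hε : 0 < ε) :
    ∀ᶠ w : ℝ in atTop,
      ‖(∑ n ∈ Icc 1 ⌊Real.exp (Real.exp (w ^ 8))⌋₊, Complex.exp
          ((θ * (((#(n + n.divisors.card).primeFactors : ℝ) - w ^ 8) / w ^ 4) : ℝ) * Complex.I)) /
          ⌊Real.exp (Real.exp (w ^ 8))⌋₊ -
        primeTwistMean (primesBetween (2 * w ^ 3) (w ^ 8 - 4 * w ^ 3))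
          (Complex.exp ((θ / w ^ 4 : ℝ) * Complex.I)) *
          Complex.exp ((-(θ * w ^ 4) : ℝ) * Complex.I)‖ ≤ ε := by
  obtain ⟨B, A, hA, hB⟩ := exists_eventually_card_divisors_notMem_le (ε := ε / 8) (by positivity)
  set D : ℝ := B * (2 * A + B + 2)
  set T := typicalDivisorCounts B A
  have hTD : ∀ᶠ w : ℝ in atTop, (#(T w) : ℝ) ≤ D * w ^ 4 := by
    filter_upwards [eventually_ge_atTop 1] with w hw using card_typicalDivisorCounts_le B hA hw
  have hT := eventually_typicalDivisorCounts_le B hA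
  set η : ℝ := ε / (4 * (|θ| + 1)) with hη
  have hη0 : 0 < η := by positivity
  have hθη : |θ| * η ≤ ε / 4 := by
    rw [hη, mul_div_assoc', div_le_div_iff₀ (by positivity) (by norm_num)]
    nlinarith [abs_nonneg θ]
  filter_upwards [hB, eventually_card_lt_card_primeFactors_sub_le hη0 hTD hT,
    exists_eventually_norm_sum_primeTwist_card_divisors_le D T hTD hT
      (fun w => Complex.exp ((θ / w ^ 4 : ℝ) * Complex.I))
      (fun w => Complex.norm_exp_ofReal_mul_I _),
    eventually_const_div_le (32 * D / η ^ 2) (ε := ε / 8) (by positivity),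
    eventually_const_div_le (20 + 6 * √D) (ε := ε / 4) (by positivity),
    eventually_ge_atTop 1] with w hB hC hS hwC hwS hw
  have hw4 : 0 < w ^ 4 := by positivity
  set R := primesBetween (2 * w ^ 3) (w ^ 8 - 4 * w ^ 3)
  set N := ⌊Real.exp (Real.exp (w ^ 8))⌋₊
  set ζ := Complex.exp ((θ / w ^ 4 : ℝ) * Complex.I) with hζdef
  have hζ : ‖ζ‖ = 1 := Complex.norm_exp_ofReal_mul_I _
  set e := Complex.exp ((-(θ * w ^ 4) : ℝ) * Complex.I) with he_def
  have he : ‖e‖ = 1 := Complex.norm_exp_ofReal_mul_I _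
  have hN : 0 < (N : ℝ) := by
    refine Nat.cast_pos.2 (Nat.floor_pos.2 (Real.one_le_exp (Real.exp_pos _).le))
  have hR : ∀ r ∈ R, r.Prime := fun r hr => (mem_primesBetween.1 hr).1
  have hmain := norm_sum_sub_const_le (Icc 1 N) (fun n => n.divisors.card ∈ T w)
    (fun n => η * w ^ 4 < (#(n + n.divisors.card).primeFactors : ℝ) -
        #{r ∈ R | r ∣ n + n.divisors.card})
    (F := fun n => Complex.exp
      ((θ * (((#(n + n.divisors.card).primeFactors : ℝ) - w ^ 8) / w ^ 4) : ℝ) * Complex.I))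
    (F' := fun n => primeTwist R ζ (n + n.divisors.card) * e)
    (M := primeTwistMean R ζ * e) (δ := ε / 4) (by positivity)
    (fun n => (Complex.norm_exp_ofReal_mul_I _).le)
    (fun n => by rw [norm_mul, he, mul_one]; exact norm_primeTwist_le R hζ _)
    (by rw [norm_mul, he, mul_one]; exact norm_primeTwistMean_le hR hζ) ?_
  · have h1 : ∑ n ∈ Icc 1 N, (if n.divisors.card ∈ T w then
        primeTwist R ζ (n + n.divisors.card) * e - primeTwistMean R ζ * e else 0) =
        (∑ n ∈ Icc 1 N, if n.divisors.card ∈ T w then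
          primeTwist R ζ (n + n.divisors.card) - primeTwistMean R ζ else 0) * e := by
      rw [sum_mul]
      refine sum_congr rfl fun n _ => ?_
      split_ifs <;> ring
    rw [h1, norm_mul, he, mul_one, Nat.card_Icc, Nat.add_sub_cancel] at hmain
    rw [sum_sub_distrib, sum_const, Nat.card_Icc, Nat.add_sub_cancel, nsmul_eq_mul] at hmain
    have h2 : ∀ z m : ℂ, ‖z / N - m‖ = ‖z - N * m‖ / N := fun z m => by
      have hN' : (N : ℂ) ≠ 0 := by exact_mod_cast hN.ne'
      rw [← Complex.norm_natCast N, ← norm_div, sub_div, mul_div_cancel_left₀ _ hN']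
    rw [h2, div_le_iff₀ hN]
    have h3 : (N : ℝ) * (32 * D / (η ^ 2 * w)) ≤ N * (ε / 8) := by
      rw [← div_div]
      gcongr
    have h4 : (N : ℝ) * ((20 + 6 * √D) / w) ≤ N * (ε / 4) := by gcongr
    linarith
  · intro n hn _ hq
    have hn1 := (mem_Icc.1 hn).1
    rw [primeTwist_eq_pow, hζdef, he_def, ← Complex.exp_nat_mul, ← Complex.exp_add]
    set m := n + n.divisors.card
    have hle : (#{r ∈ R | r ∣ m} : ℝ) ≤ #m.primeFactors := by
      exact_mod_cast card_dvd_primesBetween_le _ _ (by omega)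
    have e1 : (#{r ∈ R | r ∣ m} : ℂ) * ((θ / w ^ 4 : ℝ) * Complex.I) +
        (-(θ * w ^ 4) : ℝ) * Complex.I =
        ((#{r ∈ R | r ∣ m} * (θ / w ^ 4) - θ * w ^ 4 : ℝ) : ℂ) * Complex.I := by
      push_cast; ring
    rw [e1]
    refine (norm_exp_ofReal_mul_I_sub_exp_le _ _).trans (le_trans ?_ hθη)
    have e2 : θ * (((#m.primeFactors : ℝ) - w ^ 8) / w ^ 4) -
        (#{r ∈ R | r ∣ m} * (θ / w ^ 4) - θ * w ^ 4) =
        θ * (((#m.primeFactors : ℝ) - #{r ∈ R | r ∣ m}) / w ^ 4) := by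
      field_simp
      ring
    rw [e2, abs_mul]
    refine mul_le_mul_of_nonneg_left ?_ (abs_nonneg θ)
    rw [abs_of_nonneg (div_nonneg (sub_nonneg.2 hle) hw4.le), div_le_iff₀ hw4]
    exact not_lt.1 hq

open Finset Topology in
theorem tendsto_average_exp_card_primeFactors (θ : ℝ) :
    Tendsto (fun w : ℝ => (∑ n ∈ Icc 1 ⌊Real.exp (Real.exp (w ^ 8))⌋₊, Complex.exp
      ((θ * (((#(n + n.divisors.card).primeFactors : ℝ) - w ^ 8) / w ^ 4) : ℝ) * Complex.I)) /
      ⌊Real.exp (Real.exp (w ^ 8))⌋₊) atTop (𝓝 (Complex.exp (-θ ^ 2 / 2))) := by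
  refine tendsto_of_tendsto_of_dist (tendsto_primeTwistMean_mul_exp θ) ?_
  rw [Metric.tendsto_nhds]
  intro ε hε
  filter_upwards [eventually_norm_average_exp_card_primeFactors_sub_le θ (half_pos hε)] with w hw
  rw [Real.dist_0_eq_abs, abs_of_nonneg dist_nonneg, dist_comm, dist_eq_norm]
  linarith

open Finset MeasureTheory in
theorem charFun_smul_sum_dirac {α : Type*} (s : Finset α) (f : α → ℝ) (θ : ℝ) :
    charFun ((#s : ENNReal)⁻¹ • ∑ a ∈ s, Measure.dirac (f a)) θ =
      (∑ a ∈ s, Complex.exp ((θ * f a : ℝ) * Complex.I)) / #s := by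
  rw [charFun_apply_real, integral_smul_measure, integral_finsetSum_measure
    (fun a _ => integrable_dirac (by simp))]
  simp only [integral_dirac, ENNReal.toReal_inv, ENNReal.toReal_natCast, Complex.real_smul]
  push_cast
  rw [div_eq_inv_mul]

open Finset MeasureTheory in
theorem smul_sum_dirac_Iic {α : Type*} (s : Finset α) (f : α → ℝ) (u : ℝ) :
    (((#s : ENNReal)⁻¹ • ∑ a ∈ s, Measure.dirac (f a)) (Set.Iic u)).toReal =
      #{a ∈ s | f a ≤ u} / #s := by
  rw [Measure.smul_apply, Measure.finsetSum_apply]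
  simp only [Measure.dirac_apply' _ measurableSet_Iic, smul_eq_mul, ENNReal.toReal_mul,
    ENNReal.toReal_inv, ENNReal.toReal_natCast, Set.indicator_apply, Set.mem_Iic, Pi.one_apply]
  rw [← Nat.cast_one, ← Nat.cast_zero]
  simp only [← Nat.cast_ite]
  rw [← Nat.cast_sum, ENNReal.toReal_natCast, card_filter, div_eq_inv_mul]

open MeasureTheory ProbabilityTheory in
theorem gaussianReal_zero_one_Iic (u : ℝ) : (gaussianReal 0 1 (Set.Iic u)).toReal =
    (Real.sqrt (2 * Real.pi))⁻¹ * ∫ t in Set.Iic u, Real.exp (-t ^ 2 / 2) := by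
  rw [gaussianReal_apply_eq_integral _ one_ne_zero, ENNReal.toReal_ofReal
    (setIntegral_nonneg measurableSet_Iic fun x _ => gaussianPDFReal_nonneg _ _ x),
    ← integral_const_mul]
  simp [gaussianPDFReal]

open Finset MeasureTheory ProbabilityTheory Topology in
/-- Convergence of characteristic functions to the standard normal one gives convergence of
distribution functions, for uniform measures on finite sets. -/
theorem tendsto_card_le_div_of_tendsto_average_exp {ι α : Type*} {l : Filter ι}
    [l.IsCountablyGenerated] {s : ι → Finset α} (hs : ∀ i, (s i).Nonempty) {f : ι → α → ℝ}
    (h : ∀ θ : ℝ, Tendsto (fun i => (∑ a ∈ s i, Complex.exp ((θ * f i a : ℝ) * Complex.I)) / #(s i))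
      l (𝓝 (Complex.exp (-θ ^ 2 / 2)))) (u : ℝ) :
    Tendsto (fun i => (#{a ∈ s i | f i a ≤ u} : ℝ) / #(s i)) l
      (𝓝 ((Real.sqrt (2 * Real.pi))⁻¹ * ∫ t in Set.Iic u, Real.exp (-t ^ 2 / 2))) := by
  have hprob : ∀ i, IsProbabilityMeasure
      ((#(s i) : ENNReal)⁻¹ • ∑ a ∈ s i, Measure.dirac (f i a)) := fun i => ⟨by
    rw [Measure.smul_apply, Measure.finsetSum_apply]
    simp only [measure_univ, sum_const, nsmul_eq_mul, mul_one, smul_eq_mul]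
    exact ENNReal.inv_mul_cancel (by simpa using (hs i).ne_empty) (ENNReal.natCast_ne_top _)⟩
  refine tendsto_of_seq_tendsto fun x hx => ?_
  let μ : ℕ → ProbabilityMeasure ℝ := fun k => ⟨_, hprob (x k)⟩
  let γ : ProbabilityMeasure ℝ := ⟨gaussianReal 0 1, inferInstance⟩
  have hlim : Tendsto μ atTop (𝓝 γ) := by
    refine ProbabilityMeasure.tendsto_of_tendsto_charFun fun θ => ?_
    have hγ : charFun (γ : Measure ℝ) θ = Complex.exp (-θ ^ 2 / 2) := by
      change charFun (gaussianReal 0 1) θ = _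
      rw [charFun_gaussianReal]
      congr 1
      push_cast
      ring
    rw [hγ]
    refine ((h θ).comp hx).congr fun k => ?_
    exact (charFun_smul_sum_dirac _ _ _).symm
  have hnull : (γ : Measure ℝ) (frontier (Set.Iic u)) = 0 := by
    change gaussianReal 0 1 _ = 0
    have := nullSingletonClass_gaussianReal (μ := 0) (v := 1) one_ne_zero
    rw [frontier_Iic]
    exact measure_singleton u
  have hE := (ENNReal.tendsto_toReal (measure_ne_top _ _)).comp
    (ProbabilityMeasure.tendsto_measure_of_null_frontier_of_tendsto' hlim hnull)
  rw [← gaussianReal_zero_one_Iic]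
  refine hE.congr fun k => ?_
  exact smul_sum_dirac_Iic _ _ _

open Finset Topology in
theorem tendsto_card_primeFactors_le_div (u : ℝ) :
    Tendsto (fun w : ℝ => (#{n ∈ Icc 1 ⌊Real.exp (Real.exp (w ^ 8))⌋₊ |
      ((#(n + n.divisors.card).primeFactors : ℝ) - w ^ 8) / w ^ 4 ≤ u} : ℝ) /
        ⌊Real.exp (Real.exp (w ^ 8))⌋₊) atTop
      (𝓝 ((Real.sqrt (2 * Real.pi))⁻¹ * ∫ t in Set.Iic u, Real.exp (-t ^ 2 / 2))) := by
  have h := tendsto_card_le_div_of_tendsto_average_exp (l := (atTop : Filter ℝ))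
    (s := fun w => Icc 1 ⌊Real.exp (Real.exp (w ^ 8))⌋₊)
    (fun w => nonempty_Icc.2 (Nat.floor_pos.2 (Real.one_le_exp (Real.exp_pos _).le)))
    (f := fun w n => ((#(n + n.divisors.card).primeFactors : ℝ) - w ^ 8) / w ^ 4)
    (fun θ => by
      simpa only [Nat.card_Icc, Nat.add_sub_cancel] using tendsto_average_exp_card_primeFactors θ) u
  simpa only [Nat.card_Icc, Nat.add_sub_cancel] using h

theorem tendsto_log_log_rpow_atTop :
    Tendsto (fun x : ℝ => Real.log (Real.log x) ^ (1 / 8 : ℝ)) atTop atTop :=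
  (tendsto_rpow_atTop (by norm_num)).comp (Real.tendsto_log_atTop.comp Real.tendsto_log_atTop)

open Finset Topology in
theorem tendsto_card_Icc_one_le_div (u : ℝ) :
    Tendsto (fun x : ℝ => (#{n ∈ Icc 1 ⌊x⌋₊ |
      (#(n + n.divisors.card).primeFactors : ℝ) - Real.log (Real.log x) ≤
        u * √(Real.log (Real.log x))} : ℝ) / x) atTop
      (𝓝 ((Real.sqrt (2 * Real.pi))⁻¹ * ∫ t in Set.Iic u, Real.exp (-t ^ 2 / 2))) := by
  have h := ((tendsto_card_primeFactors_le_div u).comp tendsto_log_log_rpow_atTop).mul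
    (tendsto_nat_floor_div_atTop (R := ℝ))
  rw [mul_one] at h
  refine h.congr' ?_
  filter_upwards [eventually_gt_atTop (Real.exp (Real.exp 0))] with x hx
  have hx0 : 0 < x := (Real.exp_pos _).trans hx
  have hx1 : Real.exp 0 < Real.log x := (Real.lt_log_iff_exp_lt hx0).2 hx
  have hl0 : 0 < Real.log x := (Real.exp_pos _).trans hx1
  have hll : 0 < Real.log (Real.log x) := (Real.lt_log_iff_exp_lt hl0).2 hx1
  have h8 : (Real.log (Real.log x) ^ (1 / 8 : ℝ)) ^ 8 = Real.log (Real.log x) := by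
    rw [← Real.rpow_natCast, ← Real.rpow_mul hll.le]
    norm_num
  have h4 : (Real.log (Real.log x) ^ (1 / 8 : ℝ)) ^ 4 = √(Real.log (Real.log x)) := by
    rw [← Real.rpow_natCast, ← Real.rpow_mul hll.le, Real.sqrt_eq_rpow]
    norm_num
  have hN : (⌊x⌋₊ : ℝ) ≠ 0 := by
    have : 1 ≤ x := (Real.one_le_exp (Real.exp_pos 0).le).trans hx.le
    exact Nat.cast_ne_zero.2 (Nat.floor_pos.2 this).ne'
  simp only [Function.comp_apply, h8, h4, Real.exp_log hl0, Real.exp_log hx0,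
    div_le_iff₀ (Real.sqrt_pos.2 hll)]
  rw [div_mul_div_cancel₀ hN]

/-- Erdős–Kac law for ω(n + τ(n)), where τ(n) is the number of divisors of n. -/
theorem erdosKac_add_divisor_count (u : ℝ) :
    Tendsto (fun x : ℝ =>
      (((Finset.Icc 2 ⌊x⌋₊).filter (fun n : ℕ =>
        ((((n + n.divisors.card).primeFactors.card : ℝ) : ℝ)) - Real.log (Real.log x)
          ≤ u * Real.sqrt (Real.log (Real.log x)))).card : ℝ) / x)
      atTop
      (nhds ((Real.sqrt (2 * Real.pi))⁻¹ * ∫ t in Set.Iic u, Real.exp (-t ^ 2 / 2))) := by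
  refine tendsto_of_tendsto_of_dist (tendsto_card_Icc_one_le_div u) ?_
  refine squeeze_zero' (Eventually.of_forall fun _ => dist_nonneg) ?_
    (tendsto_const_nhds.div_atTop tendsto_id : Tendsto (fun x : ℝ => 1 / x) atTop (nhds 0))
  filter_upwards [eventually_gt_atTop 0] with x hx
  rw [Real.dist_eq, ← sub_div, abs_div, abs_of_pos hx]
  refine div_le_div_of_nonneg_right ?_ hx.le
  set p : ℕ → Prop := fun n => ((n + n.divisors.card).primeFactors.card : ℝ) -
    Real.log (Real.log x) ≤ u * Real.sqrt (Real.log (Real.log x))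
  have h1 : ((Finset.Icc 2 ⌊x⌋₊).filter p).card ≤ ((Finset.Icc 1 ⌊x⌋₊).filter p).card :=
    Finset.card_le_card (Finset.filter_subset_filter _ (Finset.Icc_subset_Icc_left (by norm_num)))
  have h2 : ((Finset.Icc 1 ⌊x⌋₊).filter p).card ≤ ((Finset.Icc 2 ⌊x⌋₊).filter p).card + 1 := by
    refine (Finset.card_le_card (t := insert 1 ((Finset.Icc 2 ⌊x⌋₊).filter p)) fun n hn => ?_).trans
      (Finset.card_insert_le _ _)
    rw [Finset.mem_filter, Finset.mem_Icc] at hn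
    rw [Finset.mem_insert, Finset.mem_filter, Finset.mem_Icc]
    rcases hn.1.1.eq_or_lt with h | h
    · exact Or.inl h.symm
    · exact Or.inr ⟨⟨h, hn.1.2⟩, hn.2⟩
  have h1' : (((Finset.Icc 2 ⌊x⌋₊).filter p).card : ℝ) ≤ ((Finset.Icc 1 ⌊x⌋₊).filter p).card := by
    exact_mod_cast h1
  have h2' : (((Finset.Icc 1 ⌊x⌋₊).filter p).card : ℝ) ≤
    ((Finset.Icc 2 ⌊x⌋₊).filter p).card + 1 := by exact_mod_cast h2
  rw [abs_le]
  constructor <;> linarith
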